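/- arXiv:1705.10893 — 4 statements merged into one kernel-verified Lean document; each statement's English description precedes it below -/
import Mathlib

section
/- In the directed Chung-Lu model, for every node y and every integer r ≥ 1, the expected number of present paths of length r starting at y satisfies E[P_r(y)] ≥ b_y·(a·b/S)^{r−1}, and the expected total number of present paths of length r satisfies E[P_r] ≥ S·(a·b/S)^{r−1}. -/
open Finset

noncomputable section
open scoped Classical

/-- Probability of observing the edge configuration `ω` when the directed edge `(i,j)`
is present independently with probability `p i j`. -/
def configProb (N : ℕ) (p : Fin N → Fin N → ℝ) (ω : Fin N → Fin N → Bool) : ℝ :=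
  ∏ i : Fin N, ∏ j : Fin N, if ω i j then p i j else 1 - p i j

/-- Expectation of the functional `f` of the random edge configuration. -/
def expect (N : ℕ) (p : Fin N → Fin N → ℝ) (f : (Fin N → Fin N → Bool) → ℝ) : ℝ :=
  ∑ ω : Fin N → Fin N → Bool, configProb N p ω * f ω

/-- Number of present paths of length `r` starting at `y`: tuples `(y, i₁, …, i_r)`
all of whose consecutive edges are present in `ω`. -/
def pathCountFrom (N r : ℕ) (y : Fin N) (ω : Fin N → Fin N → Bool) : ℕ :=
  (Finset.univ.filter (fun c : Fin (r + 1) → Fin N =>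
      c 0 = y ∧ ∀ k : Fin r, ω (c k.castSucc) (c k.succ) = true)).card

/-- Total number of present paths of length `r`. -/
def pathCountTotal (N r : ℕ) (ω : Fin N → Fin N → Bool) : ℕ :=
  (Finset.univ.filter (fun c : Fin (r + 1) → Fin N =>
      ∀ k : Fin r, ω (c k.castSucc) (c k.succ) = true)).card

/-- The number of present paths from `y` is the number of continuations `c` of `y` whose
edges are all present. -/
theorem pathCountFrom_eq_sum (N r : ℕ) (y : Fin N) (ω : Fin N → Fin N → Bool) :
    (pathCountFrom N r y ω : ℝ) = ∑ c : Fin r → Fin N,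
      if ∀ k : Fin r, ω ((Fin.cons y c : Fin (r + 1) → Fin N) k.castSucc) (c k) = true
        then (1 : ℝ) else 0 := by
  unfold pathCountFrom
  rw [Finset.card_filter, Nat.cast_sum,
    ← (Fin.consEquiv (fun _ : Fin (r + 1) => Fin N)).sum_comp, Fintype.sum_prod_type,
    Finset.sum_eq_single y]
  · simp [Fin.consEquiv]
  · intro z _ hz
    simp [Fin.consEquiv, hz]
  · simp

theorem pathCountTotal_eq_sum (N r : ℕ) (ω : Fin N → Fin N → Bool) :
    pathCountTotal N r ω = ∑ y, pathCountFrom N r y ω := by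
  unfold pathCountTotal pathCountFrom
  rw [Finset.card_eq_sum_card_fiberwise (f := fun c : Fin (r + 1) → Fin N => c 0)
    (t := Finset.univ) (fun _ _ => by simp)]
  refine Finset.sum_congr rfl fun y _ => ?_
  rw [Finset.filter_filter]
  simp only [and_comm]

theorem expect_sum {ι : Type*} (s : Finset ι) (N : ℕ) (p : Fin N → Fin N → ℝ)
    (f : ι → (Fin N → Fin N → Bool) → ℝ) :
    expect N p (fun ω => ∑ i ∈ s, f i ω) = ∑ i ∈ s, expect N p (f i) := by
  unfold _root_.expect
  simp only [Finset.mul_sum]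
  exact Finset.sum_comm

/-- Independence: the expectation of a product of functions of the single edges factors. -/
theorem expect_prod (N : ℕ) (p : Fin N → Fin N → ℝ) (g : Fin N → Fin N → Bool → ℝ) :
    expect N p (fun ω => ∏ i, ∏ j, g i j (ω i j)) =
      ∏ i, ∏ j, (p i j * g i j true + (1 - p i j) * g i j false) := by
  have h : ∀ i j, p i j * g i j true + (1 - p i j) * g i j false =
      ∑ x : Bool, (if x then p i j else 1 - p i j) * g i j x := by
    intro i j
    simp
  simp only [h, Fintype.prod_sum, _root_.expect, configProb, ← Finset.prod_mul_distrib]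

/-- The probability that all the edges of `E` are present. -/
theorem expect_indicator_edges (N : ℕ) (p : Fin N → Fin N → ℝ) (E : Finset (Fin N × Fin N)) :
    expect N p (fun ω => if ∀ e ∈ E, ω e.1 e.2 = true then 1 else 0) = ∏ e ∈ E, p e.1 e.2 := by
  have h : (fun ω : Fin N → Fin N → Bool =>
      if ∀ e ∈ E, ω e.1 e.2 = true then (1 : ℝ) else 0) =
      fun ω => ∏ i, ∏ j, if (i, j) ∈ E then (if ω i j = true then (1 : ℝ) else 0) else 1 := by
    funext ω
    rw [← Fintype.prod_prod_type' (f := fun i j =>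
      if (i, j) ∈ E then (if ω i j = true then (1 : ℝ) else 0) else 1)]
    simp [Finset.prod_ite_mem, Finset.prod_ite_zero]
  rw [h]
  refine (expect_prod N p
    (fun i j x => if (i, j) ∈ E then (if x = true then (1 : ℝ) else 0) else 1)).trans ?_
  rw [← Fintype.prod_prod_type']
  rw [← Finset.univ_inter E, ← Finset.prod_ite_mem]
  refine Finset.prod_congr rfl fun e _ => ?_
  by_cases he : e ∈ E <;> simp [he]

theorem prod_comp_le_prod_image {ι α : Type*} [DecidableEq α] (s : Finset ι)
    (e : ι → α) (f : α → ℝ) (h0 : ∀ x, 0 ≤ f x) (h1 : ∀ x, f x ≤ 1) :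
    ∏ k ∈ s, f (e k) ≤ ∏ x ∈ s.image e, f x := by
  induction s using Finset.induction_on with
  | empty => simp
  | insert k s hk ih =>
    rw [Finset.prod_insert hk, Finset.image_insert]
    by_cases he : e k ∈ s.image e
    · rw [Finset.insert_eq_of_mem he]
      exact (mul_le_of_le_one_left (Finset.prod_nonneg fun _ _ => h0 _) (h1 _)).trans ih
    · rw [Finset.prod_insert he]
      exact mul_le_mul_of_nonneg_left ih (h0 _)

theorem sum_prod_le_expect_pathCountFrom (N r : ℕ) (p : Fin N → Fin N → ℝ)
    (h0 : ∀ i j, 0 ≤ p i j) (h1 : ∀ i j, p i j ≤ 1) (y : Fin N) :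
    ∑ c : Fin r → Fin N, ∏ k : Fin r, p ((Fin.cons y c : Fin (r + 1) → Fin N) k.castSucc) (c k) ≤
      expect N p (fun ω => (pathCountFrom N r y ω : ℝ)) := by
  simp only [pathCountFrom_eq_sum]
  rw [expect_sum]
  refine Finset.sum_le_sum fun c _ => ?_
  refine (prod_comp_le_prod_image Finset.univ
    (fun k : Fin r => ((Fin.cons y c : Fin (r + 1) → Fin N) k.castSucc, c k))
    (fun e => p e.1 e.2) (fun _ => h0 _ _) (fun _ => h1 _ _)).trans_eq ?_
  rw [← expect_indicator_edges]
  simp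

/-- The total weight of the paths of length `r + 1` starting at `y`, for a rank-one kernel. -/
theorem sum_prod_rank_one (N r : ℕ) (a b : Fin N → ℝ) (S : ℝ) (hS : S ≠ 0)
    (hSa : ∑ i, a i = S) (y : Fin N) :
    ∑ c : Fin (r + 1) → Fin N, ∏ k : Fin (r + 1),
      b ((Fin.cons y c : Fin (r + 2) → Fin N) k.castSucc) * a (c k) / S =
      b y * ((∑ i, a i * b i) / S) ^ r := by
  induction r generalizing y with
  | zero =>
    rw [← (Equiv.funUnique (Fin 1) (Fin N)).symm.sum_comp]
    simp [← Finset.sum_div, ← Finset.mul_sum, hSa, hS]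
  | succ r ih =>
    rw [← (Fin.consEquiv (fun _ : Fin (r + 2) => Fin N)).sum_comp, Fintype.sum_prod_type]
    have h : ∀ z : Fin N, ∑ c : Fin (r + 1) → Fin N, ∏ k : Fin (r + 2),
        b ((Fin.cons y (Fin.cons z c : Fin (r + 2) → Fin N) : Fin (r + 3) → Fin N) k.castSucc) *
          a ((Fin.cons z c : Fin (r + 2) → Fin N) k) / S =
        b y * a z / S * (b z * ((∑ i, a i * b i) / S) ^ r) := by
      intro z
      rw [← ih z, Finset.mul_sum]
      refine Finset.sum_congr rfl fun c _ => ?_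
      rw [Fin.prod_univ_succ]
      simp
    refine (Finset.sum_congr rfl fun z _ => h z).trans ?_
    rw [pow_succ', Finset.sum_div, Finset.sum_mul, Finset.mul_sum]
    exact Finset.sum_congr rfl fun z _ => by ring

/-- In the directed Chung-Lu model, `E[P_r(y)] ≥ b_y (a·b/S)^(r-1)` and
`E[P_r] ≥ S (a·b/S)^(r-1)`. -/
theorem expected_paths_lower_bound
    (N : ℕ) (a b : Fin N → ℝ) (ha : ∀ i, 0 ≤ a i) (hb : ∀ i, 0 ≤ b i)
    (S : ℝ) (hS : 0 < S) (hSa : ∑ i, a i = S) (hSb : ∑ i, b i = S)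
    (hmax : ∀ i j, a i * b j ≤ S)
    (r : ℕ) (hr : 1 ≤ r) (y : Fin N) :
    b y * ((∑ i, a i * b i) / S) ^ (r - 1) ≤
        expect N (fun i j => b i * a j / S) (fun ω => (pathCountFrom N r y ω : ℝ)) ∧
      S * ((∑ i, a i * b i) / S) ^ (r - 1) ≤
        expect N (fun i j => b i * a j / S) (fun ω => (pathCountTotal N r ω : ℝ)) := by
  obtain ⟨n, rfl⟩ := Nat.exists_eq_add_of_le' hr
  have key : ∀ z, b z * ((∑ i, a i * b i) / S) ^ n ≤
      expect N (fun i j => b i * a j / S) (fun ω => (pathCountFrom N (n + 1) z ω : ℝ)) := by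
    intro z
    rw [← sum_prod_rank_one N n a b S hS.ne' hSa z]
    refine sum_prod_le_expect_pathCountFrom N (n + 1) (fun i j => b i * a j / S) ?_ ?_ z
    · exact fun i j => div_nonneg (mul_nonneg (hb i) (ha j)) hS.le
    · intro i j
      rw [div_le_one hS, mul_comm]
      exact hmax j i
  rw [Nat.add_sub_cancel]
  refine ⟨key y, ?_⟩
  simp only [pathCountTotal_eq_sum, Nat.cast_sum]
  rw [expect_sum]
  calc S * ((∑ i, a i * b i) / S) ^ n = ∑ z, b z * ((∑ i, a i * b i) / S) ^ n := by
        rw [← Finset.sum_mul, hSb]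
    _ ≤ _ := Finset.sum_le_sum fun z _ => key z
end
end

section
/- In the directed Chung-Lu model, assume S/(a·b) < 1/2 and let r be a positive integer with r < a·b/S. Then for every node y, the expected number of present paths of length r starting at y satisfies E[P_r(y)] ≤ 2·b_y·(a·b/S)^{r−1}·exp( p_max·r²·(S/(a·b))² / (1 − r·S/(a·b)) ). -/
open Finset

noncomputable section
open scoped Classical

/-- The edge set `E` is contained in the configuration `ω`, as a real-valued indicator. -/
def edgesPresent (N : ℕ) (E : Finset (Fin N × Fin N)) (ω : Fin N → Fin N → Bool) : ℝ :=
  ∏ i : Fin N, ∏ j : Fin N, if (i, j) ∈ E then (if ω i j then 1 else 0) else 1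

/-- Sum over the walks with `n` steps from `x` of the product of the probabilities of the distinct
edges they use outside `E`. -/
def walkWeight (N : ℕ) (p : Fin N → Fin N → ℝ) :
    ℕ → Finset (Fin N × Fin N) → Fin N → ℝ
  | 0, _, _ => 1
  | n + 1, E, x => ∑ v, (if (x, v) ∈ E then 1 else p x v) * walkWeight N p n (insert (x, v) E) v

/-- Number of edges of `E` starting at `x`. -/
def outDeg (N : ℕ) (E : Finset (Fin N × Fin N)) (x : Fin N) : ℝ :=
  ∑ v, if (x, v) ∈ E then 1 else 0

theorem sum_configs_prod (N : ℕ) (g : Fin N → Fin N → Bool → ℝ) :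
    ∑ ω : Fin N → Fin N → Bool, ∏ i, ∏ j, g i j (ω i j) = ∏ i, ∏ j, ∑ t, g i j t := by
  have h1 : ∀ i, ∏ j, ∑ t, g i j t = ∑ f : Fin N → Bool, ∏ j, g i j (f j) := by
    intro i
    rw [Finset.prod_univ_sum, Fintype.piFinset_univ]
  simp_rw [h1]
  rw [Finset.prod_univ_sum, Fintype.piFinset_univ]

theorem expect_edgesPresent (N : ℕ) (p : Fin N → Fin N → ℝ) (E : Finset (Fin N × Fin N)) :
    expect N p (edgesPresent N E) = ∏ e ∈ E, p e.1 e.2 := by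
  have h := sum_configs_prod N (fun i j t => (if t then p i j else 1 - p i j) *
    (if (i, j) ∈ E then (if t then 1 else 0) else 1))
  unfold _root_.expect configProb edgesPresent
  simp_rw [← Finset.prod_mul_distrib]
  refine h.trans ?_
  have h2 : ∀ i j : Fin N, (∑ t : Bool, (if t then p i j else 1 - p i j) *
      (if (i, j) ∈ E then (if t then (1 : ℝ) else 0) else 1)) =
      if (i, j) ∈ E then p i j else 1 := by
    intro i j
    by_cases hE : (i, j) ∈ E <;> simp [hE]
  simp_rw [h2]
  rw [← Fintype.prod_prod_type' (fun i j => if (i, j) ∈ E then p i j else 1)]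
  simp [Finset.prod_ite_mem]

theorem edgesPresent_eq (N : ℕ) (E : Finset (Fin N × Fin N)) (ω : Fin N → Fin N → Bool) :
    edgesPresent N E ω = if ∀ e ∈ E, ω e.1 e.2 = true then 1 else 0 := by
  unfold edgesPresent
  rw [← Fintype.prod_prod_type'
    (fun i j => if (i, j) ∈ E then (if ω i j then (1 : ℝ) else 0) else 1)]
  simp [Finset.prod_ite_mem, Finset.prod_ite_zero]

theorem edgesPresent_insert (N : ℕ) (E : Finset (Fin N × Fin N)) (x v : Fin N)
    (ω : Fin N → Fin N → Bool) :
    edgesPresent N (insert (x, v) E) ω = edgesPresent N E ω * if ω x v then 1 else 0 := by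
  simp only [edgesPresent_eq, Finset.forall_mem_insert]
  by_cases h : ω x v = true <;> simp [h]

theorem pathCountFrom_zero (N : ℕ) (y : Fin N) (ω : Fin N → Fin N → Bool) :
    pathCountFrom N 0 y ω = 1 := by
  unfold pathCountFrom
  rw [Finset.card_eq_one]
  refine ⟨fun _ => y, ?_⟩
  ext c
  simp only [Finset.mem_filter, Finset.mem_univ, true_and, Finset.mem_singleton]
  constructor
  · rintro ⟨h, -⟩
    ext k
    rw [Fin.eq_zero k, h]
  · rintro rfl
    exact ⟨rfl, fun k => k.elim0⟩

theorem pathCountFrom_succ (N n : ℕ) (y : Fin N) (ω : Fin N → Fin N → Bool) :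
    (pathCountFrom N (n + 1) y ω : ℝ) =
      ∑ v, (if ω y v then 1 else 0) * (pathCountFrom N n v ω : ℝ) := by
  have h (m : ℕ) (x : Fin N) : (pathCountFrom N m x ω : ℝ) =
      ∑ c : Fin (m + 1) → Fin N,
        if c 0 = x ∧ ∀ k : Fin m, ω (c k.castSucc) (c k.succ) = true then 1 else 0 := by
    unfold pathCountFrom
    rw [Finset.sum_boole]
  simp_rw [h, Finset.mul_sum]
  rw [Finset.sum_comm, ← (Fin.consEquiv (fun _ => Fin N)).sum_comp, Fintype.sum_prod_type,
    Finset.sum_comm]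
  refine Finset.sum_congr rfl fun c _ => ?_
  rw [Finset.sum_eq_single y, Finset.sum_eq_single (c 0)]
  · by_cases hc : ω y (c 0) = true <;>
      simp [Fin.consEquiv, Fin.forall_fin_succ, hc]
  · intro v _ hv
    simp [hv.symm]
  · simp
  · intro v _ hv
    simp [Fin.consEquiv, hv]
  · simp

theorem expect_edgesPresent_mul_pathCountFrom (N : ℕ) (p : Fin N → Fin N → ℝ) (n : ℕ) :
    ∀ (E : Finset (Fin N × Fin N)) (x : Fin N),
      expect N p (fun ω => edgesPresent N E ω * pathCountFrom N n x ω) =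
        (∏ e ∈ E, p e.1 e.2) * walkWeight N p n E x := by
  induction n with
  | zero =>
    intro E x
    simp only [pathCountFrom_zero, walkWeight, Nat.cast_one, mul_one]
    exact expect_edgesPresent N p E
  | succ n ih =>
    intro E x
    have h1 : expect N p (fun ω => edgesPresent N E ω * pathCountFrom N (n + 1) x ω) =
        ∑ v, expect N p (fun ω => edgesPresent N (insert (x, v) E) ω * pathCountFrom N n v ω) := by
      unfold _root_.expect
      rw [Finset.sum_comm]
      refine Finset.sum_congr rfl fun ω _ => ?_
      beta_reduce
      rw [pathCountFrom_succ, Finset.mul_sum, Finset.mul_sum]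
      refine Finset.sum_congr rfl fun v _ => ?_
      rw [edgesPresent_insert]
      ring
    rw [h1, walkWeight, Finset.mul_sum]
    refine Finset.sum_congr rfl fun v _ => ?_
    rw [ih]
    by_cases hE : (x, v) ∈ E
    · simp [hE]
    · rw [Finset.prod_insert hE]
      simp only [hE, if_false]
      ring

theorem expect_pathCountFrom (N : ℕ) (p : Fin N → Fin N → ℝ) (n : ℕ) (x : Fin N) :
    expect N p (fun ω => (pathCountFrom N n x ω : ℝ)) = walkWeight N p n ∅ x := by
  simpa [edgesPresent] using expect_edgesPresent_mul_pathCountFrom N p n ∅ x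

theorem outDeg_nonneg (N : ℕ) (E : Finset (Fin N × Fin N)) (x : Fin N) : 0 ≤ outDeg N E x :=
  Finset.sum_nonneg fun v _ => by split_ifs <;> norm_num

theorem sum_outDeg (N : ℕ) (E : Finset (Fin N × Fin N)) : ∑ x, outDeg N E x = E.card := by
  unfold outDeg
  rw [← Fintype.sum_prod_type' (fun x v => if (x, v) ∈ E then (1 : ℝ) else 0)]
  simp

theorem outDeg_le_card (N : ℕ) (E : Finset (Fin N × Fin N)) (x : Fin N) :
    outDeg N E x ≤ E.card := by
  rw [← sum_outDeg]
  exact Finset.single_le_sum (fun v _ => outDeg_nonneg N E v) (Finset.mem_univ x)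

theorem outDeg_insert_le (N : ℕ) (E : Finset (Fin N × Fin N)) (x v : Fin N) :
    outDeg N (insert (x, v) E) v ≤ outDeg N E v + if v = x then 1 else 0 := by
  have h : (if v = x then (1 : ℝ) else 0) = ∑ u, if u = v ∧ v = x then 1 else 0 := by
    by_cases hv : v = x <;> simp [hv]
  rw [h]
  unfold outDeg
  rw [← Finset.sum_add_distrib]
  refine Finset.sum_le_sum fun u _ => ?_
  by_cases hu : u = v ∧ v = x
  · by_cases hE : (v, u) ∈ E <;> simp [hu] <;> split_ifs <;> norm_num
  · have : (v, u) ≠ (x, v) := fun he => hu ⟨(Prod.ext_iff.1 he).2, (Prod.ext_iff.1 he).1⟩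
    simp [hu, this]

/-- Geometric bound on the walk weights for edge probabilities `p x v = b x * α v`, where `A` and
`B` bound the factors `α` and `b`. -/
theorem walkWeight_le (N : ℕ) (α b : Fin N → ℝ) (hα : ∀ i, 0 ≤ α i) (hb : ∀ i, 0 ≤ b i)
    (hα1 : ∑ i, α i = 1) (A B d : ℝ) (hA : ∀ i, α i ≤ A) (hB : ∀ i, b i ≤ B)
    (hd : ∑ i, α i * b i = d) (r : ℕ) (hrd : (r : ℝ) < d) (hdB : d ≤ B) (n : ℕ) :
    ∀ (E : Finset (Fin N × Fin N)) (x : Fin N), E.card + (n + 1) ≤ r →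
      walkWeight N (fun i j => b i * α j) (n + 1) E x ≤
        (b x + B / (d - r) * outDeg N E x) * (d + r * (A * B) / (d - r)) ^ n := by
  have hdr : 0 < d - r := sub_pos.2 hrd
  have hB0 : 0 < B := by linarith
  have ht1 : 1 ≤ B / (d - r) := by rw [le_div_iff₀ hdr]; linarith
  have htB : B + B / (d - r) * r = d * (B / (d - r)) := by field_simp; ring
  have hμ : d + r * A * (B / (d - r)) = d + r * (A * B) / (d - r) := by ring
  set t := B / (d - r)
  set μ := d + r * (A * B) / (d - r) with hμ'
  induction n with
  | zero =>
    intro E x _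
    simp only [walkWeight, mul_one, pow_zero]
    calc _ ≤ ∑ v, ((if (x, v) ∈ E then 1 else 0) + b x * α v) := by
          refine Finset.sum_le_sum fun v _ => ?_
          have := mul_nonneg (hb x) (hα v)
          split_ifs <;> linarith
      _ = outDeg N E x + b x := by
          rw [Finset.sum_add_distrib, ← Finset.mul_sum, hα1, mul_one, outDeg]
      _ ≤ _ := by nlinarith [outDeg_nonneg N E x]
  | succ n ih =>
    intro E x hE
    have hA0 : 0 ≤ A := (hα x).trans (hA x)
    have hdμ : d ≤ μ := by
      rw [hμ']
      have : 0 ≤ r * (A * B) / (d - r) := by positivity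
      linarith
    have hμ0 : 0 ≤ μ := by linarith
    have hE1 : (E.card : ℝ) + 1 ≤ r := by
      have : E.card + 1 ≤ r := by omega
      exact_mod_cast this
    have hterm : ∀ v, (if (x, v) ∈ E then 1 else b x * α v) *
        walkWeight N (fun i j => b i * α j) (n + 1) (insert (x, v) E) v ≤
        ((if (x, v) ∈ E then 1 else 0) * (d * t) +
          b x * (α v * b v + t * A * (outDeg N E v + if v = x then 1 else 0))) * μ ^ n := by
      intro v
      have hcard := Finset.card_insert_le (x, v) E
      have hW := ih (insert (x, v) E) v (by omega)
      have hpow := pow_nonneg hμ0 n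
      have ho := outDeg_nonneg N E v
      have hi : (0 : ℝ) ≤ if v = x then 1 else 0 := by split_ifs <;> norm_num
      have hbx := hb x
      have hbv := hb v
      have hαv := hα v
      by_cases hmem : (x, v) ∈ E
      · rw [Finset.insert_eq_of_mem hmem] at hW ⊢
        simp only [hmem, if_true, one_mul]
        refine hW.trans (mul_le_mul_of_nonneg_right ?_ hpow)
        have h1 : t * outDeg N E v ≤ t * r :=
          mul_le_mul_of_nonneg_left (by linarith [outDeg_le_card N E v]) (by linarith)
        have h2 : 0 ≤ b x * (α v * b v + t * A * (outDeg N E v + if v = x then 1 else 0)) := by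
          positivity
        linarith [hB v]
      · simp only [hmem, if_false, zero_mul, zero_add]
        refine (mul_le_mul_of_nonneg_left hW (mul_nonneg hbx hαv)).trans ?_
        rw [← mul_assoc, mul_assoc (b x)]
        refine mul_le_mul_of_nonneg_right (mul_le_mul_of_nonneg_left ?_ hbx) hpow
        have h1 := outDeg_insert_le N E x v
        have h2 : α v * (t * outDeg N (insert (x, v) E) v) ≤
            A * (t * (outDeg N E v + if v = x then 1 else 0)) :=
          mul_le_mul (hA v) (mul_le_mul_of_nonneg_left h1 (by linarith))
            (mul_nonneg (by linarith) (outDeg_nonneg N _ v)) hA0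
        linarith
    rw [walkWeight]
    refine (Finset.sum_le_sum fun v _ => hterm v).trans ?_
    rw [← Finset.sum_mul, Finset.sum_add_distrib, ← Finset.sum_mul, ← Finset.mul_sum,
      Finset.sum_add_distrib, ← Finset.mul_sum, Finset.sum_add_distrib, sum_outDeg, hd,
      Finset.sum_ite_eq' Finset.univ x, if_pos (Finset.mem_univ x), pow_succ',
      ← mul_assoc (b x + t * outDeg N E x)]
    refine mul_le_mul_of_nonneg_right ?_ (pow_nonneg hμ0 n)
    change outDeg N E x * (d * t) + _ ≤ _
    have h1 : t * A * (E.card + 1) ≤ t * A * r := mul_le_mul_of_nonneg_left hE1 (by positivity)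
    have h2 : b x * (d + t * A * (E.card + 1)) ≤ b x * μ :=
      mul_le_mul_of_nonneg_left (by linarith) (hb x)
    have h3 : (t * outDeg N E x) * d ≤ (t * outDeg N E x) * μ :=
      mul_le_mul_of_nonneg_left hdμ (mul_nonneg (by linarith) (outDeg_nonneg N E x))
    linarith

/-- In the directed Chung-Lu model, if `S/(a·b) < 1/2` and `r < a·b/S`, then
`E[P_r(y)] ≤ 2 b_y (a·b/S)^(r-1) exp(p_max r² (S/(a·b))² / (1 - r S/(a·b)))`. -/
theorem expected_paths_upper_bound
    (N : ℕ) (a b : Fin N → ℝ) (ha : ∀ i, 0 ≤ a i) (hb : ∀ i, 0 ≤ b i)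
    (S : ℝ) (hS : 0 < S) (hSa : ∑ i, a i = S) (hSb : ∑ i, b i = S)
    (hmax : ∀ i j, a i * b j ≤ S)
    (pmax : ℝ) (hpmax : IsGreatest {x : ℝ | ∃ i j, x = b i * a j / S} pmax)
    (hhalf : S / (∑ i, a i * b i) < 1 / 2)
    (r : ℕ) (hr : 1 ≤ r) (hrd : (r : ℝ) < (∑ i, a i * b i) / S)
    (y : Fin N) :
    expect N (fun i j => b i * a j / S) (fun ω => (pathCountFrom N r y ω : ℝ)) ≤
      2 * b y * ((∑ i, a i * b i) / S) ^ (r - 1) *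
        Real.exp (pmax * ((r : ℝ) ^ 2 * (S / (∑ i, a i * b i)) ^ 2) /
          (1 - (r : ℝ) * (S / (∑ i, a i * b i)))) := by
  have : Nonempty (Fin N) := ⟨y⟩
  obtain ⟨m, hm⟩ := Finite.exists_max b
  set D := ∑ i, a i * b i with hD
  have hr1 : (1 : ℝ) ≤ r := by exact_mod_cast hr
  have hd0 : 0 < D / S := by linarith
  have hD0 : 0 < D := by
    have := mul_pos hd0 hS
    rwa [div_mul_cancel₀ _ hS.ne'] at this
  set d := D / S with hd
  have hinv : S / D = 1 / d := by rw [hd, one_div_div]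
  have hdr : 0 < d - r := sub_pos.2 hrd
  have hdB : d ≤ b m := by
    rw [hd, div_le_iff₀ hS, hD, ← hSa, Finset.mul_sum]
    refine Finset.sum_le_sum fun i _ => ?_
    rw [mul_comm]
    exact mul_le_mul_of_nonneg_right (hm i) (ha i)
  have hB0 : 0 < b m := by linarith
  have hp : ∀ i j, b i * a j / S ≤ pmax := fun i j => hpmax.2 ⟨i, j, rfl⟩
  have hp0 : 0 ≤ pmax := (div_nonneg (mul_nonneg (hb y) (ha y)) hS.le).trans (hp y y)
  obtain ⟨n, rfl⟩ : ∃ n, r = n + 1 := ⟨r - 1, by omega⟩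
  have key := walkWeight_le N (fun i => a i / S) b (fun i => div_nonneg (ha i) hS.le) hb
    (by rw [← Finset.sum_div, hSa, div_self hS.ne']) (pmax / b m) (b m) d
    (fun i => by
      rw [le_div_iff₀ hB0]
      calc a i / S * b m = b m * a i / S := by ring
        _ ≤ pmax := hp m i)
    hm (by
      rw [hd, hD, Finset.sum_div]
      exact Finset.sum_congr rfl fun i _ => by ring)
    (n + 1) hrd hdB n ∅ y (by simp)
  rw [div_mul_cancel₀ _ hB0.ne'] at key
  have hp' : (fun i j => b i * a j / S) = fun i j => b i * (a j / S) := by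
    funext i j
    ring
  rw [expect_pathCountFrom, hp', hinv, Nat.add_sub_cancel]
  refine key.trans ?_
  set R : ℝ := ((n + 1 : ℕ) : ℝ) with hR
  have ho : outDeg N ∅ y = 0 := by simp [outDeg]
  rw [ho, mul_zero, add_zero]
  set X := pmax * (R ^ 2 * (1 / d) ^ 2) / (1 - R * (1 / d)) with hX
  set q := R * pmax / (d * (d - R)) with hq
  have hq0 : 0 ≤ q := by positivity
  have hqX : R * q = X := by
    have : 1 - R * (1 / d) ≠ 0 := by
      have h : 1 - R * (1 / d) = (d - R) / d := by field_simp
      rw [h]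
      positivity
    rw [hq, hX]
    have h : 1 - R * (1 / d) = (d - R) / d := by field_simp
    rw [h]
    field_simp
  have hμ : d + R * pmax / (d - R) = d * (1 + q) := by
    rw [hq]
    field_simp
  have hexp : (1 + q) ^ n ≤ Real.exp X := by
    calc (1 + q) ^ n ≤ Real.exp q ^ n :=
          pow_le_pow_left₀ (by linarith) (by linarith [Real.add_one_le_exp q]) n
      _ = Real.exp (n * q) := (Real.exp_nat_mul q n).symm
      _ ≤ Real.exp X := by
          rw [Real.exp_le_exp, ← hqX, hR]
          push_cast
          linarith
  rw [hμ, mul_pow, ← mul_assoc]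
  have h0 : 0 ≤ b y * d ^ n := mul_nonneg (hb y) (by positivity)
  calc b y * d ^ n * (1 + q) ^ n ≤ b y * d ^ n * Real.exp X := mul_le_mul_of_nonneg_left hexp h0
    _ ≤ 2 * b y * d ^ n * Real.exp X := by
        have := mul_nonneg h0 (Real.exp_pos X).le
        linarith
end
end

section
/- In the directed Chung-Lu model, suppose p_max ≤ R/N^τ for constants R > 0 and τ > 0, and suppose a·b/S > 1. Fix an integer t ≥ 2 and set L = ((t−1)τ/2)·log_{a·b/S}(N) and ε = t·R^{t−1}·(L+1)^{3t−2} / N^{(t−1)τ/2}. Then with probability at least 1 − ε, every present walk of length at most L has fewer than t cycle-inducing edges. -/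
open Finset

noncomputable section
open scoped Classical

/-- Probability of the event `E` under independent Bernoulli edges. -/
def prEvent (N : ℕ) (p : Fin N → Fin N → ℝ) (E : (Fin N → Fin N → Bool) → Prop) : ℝ :=
  ∑ ω : Fin N → Fin N → Bool, if E ω then configProb N p ω else 0

/-- The minimal edge list of a walk: its distinct edges, in order of first traversal. -/
def minEdgeList {V : Type*} [DecidableEq V] (w : List V) : List (V × V) :=
  ((w.zip w.tail).reverse.dedup).reverse

/-- The `m`-th edge of the edge list `E` is cycle inducing if a simple directed cycle
containing the `m`-th edge can be formed using only the first `m+1` edges `E_0, …, E_m`. -/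
def IsCycleInducing {V : Type*} (E : List (V × V)) (m : Fin E.length) : Prop :=
  ∃ c : List V, c ≠ [] ∧ c.Nodup ∧
    (∀ k : Fin c.length, (c.get k, c.get (finRotate c.length k)) ∈ E.take (m.val + 1)) ∧
    (∃ k : Fin c.length, (c.get k, c.get (finRotate c.length k)) = E.get m)

/-- The number of cycle-inducing edges of the walk `w`. -/
def numCycleInducing {V : Type*} [DecidableEq V] (w : List V) : ℕ :=
  (Finset.univ.filter (fun m : Fin (minEdgeList w).length =>
      IsCycleInducing (minEdgeList w) m)).card

/-- The number of distinct vertices seen before the `s`-th edge of an edge list whose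
cycle-inducing edges are those with index in `P`. -/
def visitedCount (P : Finset ℕ) (s : ℕ) : ℕ := 1 + ((range s) \ P).card

lemma visitedCount_succ_of_mem {P : Finset ℕ} {s : ℕ} (h : s ∈ P) :
    visitedCount P (s + 1) = visitedCount P s := by
  simp [visitedCount, range_add_one, insert_sdiff_of_mem _ h]

lemma visitedCount_succ_of_notMem {P : Finset ℕ} {s : ℕ} (h : s ∉ P) :
    visitedCount P (s + 1) = visitedCount P s + 1 := by
  rw [visitedCount, range_add_one, insert_sdiff_of_notMem _ h, card_insert_of_notMem (by simp),
    visitedCount]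
  ring

lemma visitedCount_mono (P : Finset ℕ) : Monotone (visitedCount P) := fun s s' h => by
  unfold visitedCount
  gcongr

lemma visitedCount_pos (P : Finset ℕ) (s : ℕ) : 0 < visitedCount P s := by
  unfold visitedCount; omega

lemma visitedCount_insert {P : Finset ℕ} {m s : ℕ} (h : s ≤ m) :
    visitedCount (insert m P) s = visitedCount P s := by
  unfold visitedCount
  congr 2
  ext x
  simp only [mem_sdiff, mem_range, mem_insert]
  constructor
  · rintro ⟨h1, h2⟩; exact ⟨h1, fun h3 => h2 (Or.inr h3)⟩
  · rintro ⟨h1, h2⟩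
    refine ⟨h1, ?_⟩
    rintro (h3 | h3)
    · omega
    · exact h2 h3

lemma visitedCount_add_card {P : Finset ℕ} {m : ℕ} (h : P ⊆ range m) :
    visitedCount P m + P.card = m + 1 := by
  have h1 := card_sdiff_add_card_eq_card h
  rw [card_range] at h1
  unfold visitedCount
  omega

lemma zip_tail_concat {V : Type*} (w : List V) (x y : V) :
    (w ++ [x] ++ [y]).zip (w ++ [x] ++ [y]).tail =
      (w ++ [x]).zip (w ++ [x]).tail ++ [(x, y)] := by
  induction w with
  | nil => simp
  | cons a w ih =>
    cases w with
    | nil => simp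
    | cons b w => simpa using ih

lemma map_range_update {α : Type*} (e : ℕ → α) (m : ℕ) (z : α) :
    (List.range (m + 1)).map (Function.update e m z) = (List.range m).map e ++ [z] := by
  rw [List.range_succ, List.map_append]
  congr 1
  · refine List.map_congr_left fun s hs => ?_
    rw [Function.update_of_ne (List.mem_range.1 hs).ne]
  · simp

section Exploration

variable {V : Type*} [DecidableEq V]

lemma minEdgeList_concat_of_mem {w : List V} {x y : V}
    (h : (x, y) ∈ minEdgeList (w ++ [x])) :
    minEdgeList (w ++ [x] ++ [y]) = minEdgeList (w ++ [x]) := by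
  simp only [minEdgeList, List.mem_reverse, List.mem_dedup] at h
  rw [minEdgeList, zip_tail_concat, List.reverse_append, List.reverse_singleton,
    List.singleton_append, List.dedup_cons_of_mem (by simpa using h), minEdgeList]

lemma minEdgeList_concat_of_notMem {w : List V} {x y : V}
    (h : (x, y) ∉ minEdgeList (w ++ [x])) :
    minEdgeList (w ++ [x] ++ [y]) = minEdgeList (w ++ [x]) ++ [(x, y)] := by
  simp only [minEdgeList, List.mem_reverse, List.mem_dedup] at h
  rw [minEdgeList, zip_tail_concat, List.reverse_append, List.reverse_singleton,
    List.singleton_append, List.dedup_cons_of_notMem (by simpa using h), List.reverse_cons,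
    minEdgeList]

lemma mem_minEdgeList {w : List V} {e : V × V} : e ∈ minEdgeList w ↔ e ∈ w.zip w.tail := by
  simp [minEdgeList]

lemma nodup_minEdgeList (w : List V) : (minEdgeList w).Nodup := by
  simp [minEdgeList, List.nodup_dedup]

lemma length_minEdgeList_le (w : List V) : (minEdgeList w).length ≤ w.length - 1 := by
  have := (List.dedup_sublist (w.zip w.tail).reverse).length_le
  simp only [minEdgeList, List.length_reverse, List.length_zip, List.length_tail] at this ⊢
  omega

/-- The edges of the walk `w` in order of first traversal are `e 0, …, e (m - 1)`, its vertices in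
order of first visit are `v 0, v 1, …`, and `P` is the set of indices of edges whose head was
visited earlier. -/
structure IsExploration (w : List V) (P : Finset ℕ) (v : ℕ → V) (e : ℕ → V × V) (m : ℕ) :
    Prop where
  minEdgeList_eq : minEdgeList w = (List.range m).map e
  subset_range : P ⊆ range m
  injOn : ∀ i < visitedCount P m, ∀ j < visitedCount P m, v i = v j → i = j
  mem_iff : ∀ x, x ∈ w ↔ ∃ i < visitedCount P m, v i = x
  tail_visited : ∀ s < m, ∃ i < visitedCount P s, v i = (e s).1
  head_visited : ∀ s ∈ P, ∃ i < visitedCount P s, v i = (e s).2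
  head_new : ∀ s < m, s ∉ P → (e s).2 = v (visitedCount P s)
  tail_eq : ∀ s < m, (∀ k ∈ P, k + 1 ≠ s) → (e s).1 = v (visitedCount P s - 1)
  getLast : ∀ c ∈ w.getLast?, (∃ k ∈ P, k + 1 = m) ∨
    (c = v (visitedCount P m - 1) ∧ ∀ s < m, (e s).1 ≠ c)

namespace IsExploration

variable {w : List V} {P : Finset ℕ} {v : ℕ → V} {e : ℕ → V × V} {m : ℕ}

lemma mem_minEdgeList_iff (h : IsExploration w P v e m) (z : V × V) :
    z ∈ minEdgeList w ↔ ∃ s < m, e s = z := by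
  simp [h.minEdgeList_eq]

lemma concat_of_mem {c y : V} (h : IsExploration (w ++ [c]) P v e m)
    (hy : (c, y) ∈ minEdgeList (w ++ [c])) : IsExploration (w ++ [c] ++ [y]) P v e m where
  minEdgeList_eq := (minEdgeList_concat_of_mem hy).trans h.minEdgeList_eq
  subset_range := h.subset_range
  injOn := h.injOn
  mem_iff x := by
    rw [← h.mem_iff]
    have : y ∈ w ++ [c] := List.mem_of_mem_tail (List.of_mem_zip (mem_minEdgeList.1 hy)).2
    simp only [List.mem_append, List.mem_singleton] at this ⊢
    constructor
    · rintro (hx | rfl)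
      · exact hx
      · exact this
    · exact Or.inl
  tail_visited := h.tail_visited
  head_visited := h.head_visited
  head_new := h.head_new
  tail_eq := h.tail_eq
  getLast _ _ := by
    rcases h.getLast c (by simp) with h1 | ⟨-, h1⟩
    · exact Or.inl h1
    · obtain ⟨s, hs, hse⟩ := (h.mem_minEdgeList_iff _).1 hy
      exact absurd (by rw [hse]) (h1 s hs)

lemma concat_of_visited {c y : V} (h : IsExploration (w ++ [c]) P v e m)
    (hy : (c, y) ∉ minEdgeList (w ++ [c])) (hv : y ∈ w ++ [c]) :
    IsExploration (w ++ [c] ++ [y]) (insert m P) v (Function.update e m (c, y)) (m + 1) := by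
  have hP : ∀ k ∈ P, k < m := fun k hk => mem_range.1 (h.subset_range hk)
  have hm : visitedCount (insert m P) (m + 1) = visitedCount P m := by
    rw [visitedCount_succ_of_mem (by simp), visitedCount_insert le_rfl]
  refine ⟨?_, ?_, ?_, ?_, ?_, ?_, ?_, ?_, ?_⟩
  · rw [minEdgeList_concat_of_notMem hy, map_range_update, h.minEdgeList_eq]
  · rw [range_add_one]
    exact insert_subset_insert _ h.subset_range
  · rw [hm]; exact h.injOn
  · intro x
    rw [hm, ← h.mem_iff, List.mem_append, List.mem_singleton]
    exact ⟨fun hx => hx.elim id fun hx => hx ▸ hv, Or.inl⟩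
  · intro s hs
    rw [visitedCount_insert (by omega)]
    rcases (Nat.lt_succ_iff_lt_or_eq.1 hs) with hs | rfl
    · rw [Function.update_of_ne hs.ne]; exact h.tail_visited s hs
    · rw [Function.update_self]; exact (h.mem_iff c).1 (by simp)
  · intro s hs
    rcases mem_insert.1 hs with rfl | hs
    · rw [visitedCount_insert le_rfl, Function.update_self]
      exact (h.mem_iff y).1 hv
    · rw [visitedCount_insert (hP s hs).le, Function.update_of_ne (hP s hs).ne]
      exact h.head_visited s hs
  · intro s hs hsP
    rw [mem_insert, not_or] at hsP
    rw [visitedCount_insert (by omega), Function.update_of_ne hsP.1]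
    exact h.head_new s (by omega) hsP.2
  · intro s hs hk
    rw [visitedCount_insert (by omega)]
    have hk' : ∀ k ∈ P, k + 1 ≠ s := fun k hkP => hk k (mem_insert_of_mem hkP)
    rcases (Nat.lt_succ_iff_lt_or_eq.1 hs) with hs | rfl
    · rw [Function.update_of_ne hs.ne]; exact h.tail_eq s hs hk'
    · rw [Function.update_self]
      rcases h.getLast c (by simp) with ⟨k, hk1, hk2⟩ | h1
      · exact absurd hk2 (hk' k hk1)
      · exact h1.1
  · exact fun _ _ => Or.inl ⟨m, by simp⟩

lemma concat_of_new {c y : V} (h : IsExploration (w ++ [c]) P v e m)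
    (hv : y ∉ w ++ [c]) :
    IsExploration (w ++ [c] ++ [y]) P (Function.update v (visitedCount P m) y)
      (Function.update e m (c, y)) (m + 1) := by
  have hy : (c, y) ∉ minEdgeList (w ++ [c]) := fun hy =>
    hv (List.mem_of_mem_tail (List.of_mem_zip (mem_minEdgeList.1 hy)).2)
  have hP : ∀ k ∈ P, k < m := fun k hk => mem_range.1 (h.subset_range hk)
  have hmP : m ∉ P := fun hk => (hP m hk).false
  have hm : visitedCount P (m + 1) = visitedCount P m + 1 := visitedCount_succ_of_notMem hmP
  set n := visitedCount P m with hn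
  have hnpos : 0 < n := visitedCount_pos _ _
  have hle : ∀ {s}, s ≤ m → visitedCount P s ≤ n := fun hs => visitedCount_mono P hs
  have hvv : ∀ {i}, i < n → Function.update v n y i = v i := fun hi =>
    Function.update_of_ne hi.ne _ _
  have hne : ∀ i < n, v i ≠ y := fun i hi hiy => hv ((h.mem_iff y).2 ⟨i, hi, hiy⟩)
  refine ⟨?_, ?_, ?_, ?_, ?_, ?_, ?_, ?_, ?_⟩
  · rw [minEdgeList_concat_of_notMem hy, map_range_update, h.minEdgeList_eq]
  · exact h.subset_range.trans (range_subset_range.2 (by omega))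
  · rw [hm]
    intro i hi j hj hij
    rcases (Nat.lt_succ_iff_lt_or_eq.1 hi) with hi | hi <;>
      rcases (Nat.lt_succ_iff_lt_or_eq.1 hj) with hj | hj
    · rw [hvv hi, hvv hj] at hij
      exact h.injOn i hi j hj hij
    · rw [hvv hi, hj, Function.update_self] at hij
      exact absurd hij (hne i hi)
    · rw [hvv hj, hi, Function.update_self] at hij
      exact absurd hij.symm (hne j hj)
    · omega
  · intro x
    rw [hm, List.mem_append, List.mem_singleton, h.mem_iff]
    constructor
    · rintro (⟨i, hi, hx⟩ | rfl)
      · exact ⟨i, by omega, by rw [hvv hi, hx]⟩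
      · exact ⟨n, by omega, Function.update_self _ _ _⟩
    · rintro ⟨i, hi, rfl⟩
      rcases (Nat.lt_succ_iff_lt_or_eq.1 hi) with hi | hi
      · exact Or.inl ⟨i, hi, (hvv hi).symm⟩
      · exact Or.inr (by rw [hi, Function.update_self])
  · intro s hs
    obtain ⟨i, hi, hx⟩ : ∃ i < visitedCount P s, v i = (Function.update e m (c, y) s).1 := by
      rcases (Nat.lt_succ_iff_lt_or_eq.1 hs) with hs | rfl
      · rw [Function.update_of_ne hs.ne]; exact h.tail_visited s hs
      · rw [Function.update_self]; exact (h.mem_iff c).1 (by simp)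
    exact ⟨i, hi, by rw [hvv (hi.trans_le (hle (by omega))), hx]⟩
  · intro s hs
    obtain ⟨i, hi, hx⟩ := h.head_visited s hs
    refine ⟨i, hi, ?_⟩
    rw [hvv (hi.trans_le (hle (hP s hs).le)), Function.update_of_ne (hP s hs).ne, hx]
  · intro s hs hsP
    rcases (Nat.lt_succ_iff_lt_or_eq.1 hs) with hs | rfl
    · have : visitedCount P s < n := by
        have := visitedCount_succ_of_notMem hsP
        have := hle (show s + 1 ≤ m from hs)
        omega
      rw [Function.update_of_ne hs.ne, hvv this]
      exact h.head_new s hs hsP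
    · simp [n]
  · intro s hs hk
    have := visitedCount_pos P s
    rw [hvv (by have := hle (Nat.lt_succ_iff.1 hs); omega)]
    rcases (Nat.lt_succ_iff_lt_or_eq.1 hs) with hs | rfl
    · rw [Function.update_of_ne hs.ne]; exact h.tail_eq s hs hk
    · rw [Function.update_self]
      rcases h.getLast c (by simp) with ⟨k, hk1, hk2⟩ | h1
      · exact absurd hk2 (hk k hk1)
      · exact h1.1
  · intro c' hc'
    have hc' : c' = y := by simpa [eq_comm] using hc'
    subst hc'
    refine Or.inr ⟨by rw [hm]; simp, fun s hs => ?_⟩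
    rcases (Nat.lt_succ_iff_lt_or_eq.1 hs) with hs | rfl
    · rw [Function.update_of_ne hs.ne]
      obtain ⟨i, hi, hx⟩ := h.tail_visited s hs
      rw [← hx]
      exact hne i (hi.trans_le (hle hs.le))
    · rw [Function.update_self]
      intro hcy
      exact hv (by simp [← hcy])

end IsExploration

lemma exists_isExploration (w : List V) (c : V) :
    ∃ P v e m, IsExploration (w ++ [c]) P v e m := by
  induction w using List.reverseRecOn generalizing c with
  | nil =>
    refine ⟨∅, fun _ => c, fun _ => (c, c), 0, ?_⟩
    have h0 : visitedCount ∅ 0 = 1 := by simp [visitedCount]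
    constructor <;> simp [h0, minEdgeList, eq_comm]
  | append_singleton w x ih =>
    obtain ⟨P, v, e, m, h⟩ := ih x
    by_cases hy : (x, c) ∈ minEdgeList (w ++ [x])
    · exact ⟨_, _, _, _, h.concat_of_mem hy⟩
    by_cases hv : c ∈ w ++ [x]
    · exact ⟨_, _, _, _, h.concat_of_visited hy hv⟩
    · exact ⟨_, _, _, _, h.concat_of_new hv⟩

namespace IsExploration

variable {w : List V} {P : Finset ℕ} {v : ℕ → V} {e : ℕ → V × V} {m : ℕ}

lemma length_minEdgeList (h : IsExploration w P v e m) : (minEdgeList w).length = m := by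
  simp [h.minEdgeList_eq]

lemma getElem_minEdgeList (h : IsExploration w P v e m) {s : ℕ}
    (hs : s < (minEdgeList w).length) : (minEdgeList w)[s] = e s := by
  simp [h.minEdgeList_eq]

lemma card_toFinset (h : IsExploration w P v e m) : w.toFinset.card = visitedCount P m := by
  have : w.toFinset = (range (visitedCount P m)).image v := by
    ext x
    simp [h.mem_iff]
  rw [this, card_image_of_injOn, card_range]
  intro i hi j hj hij
  exact h.injOn i (by simpa using hi) j (by simpa using hj) hij

lemma mem_of_isCycleInducing (h : IsExploration w P v e m) (s : Fin (minEdgeList w).length)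
    (hs : IsCycleInducing (minEdgeList w) s) : s.val ∈ P := by
  obtain ⟨c, hc, -, hall, k, hk⟩ := hs
  by_contra hsP
  have hsm : s.val < m := h.length_minEdgeList ▸ s.2
  have h1 := hall (finRotate _ k)
  obtain ⟨j, hj, hje⟩ := List.mem_take_iff_getElem.1 h1
  rw [h.getElem_minEdgeList] at hje
  have hjs : j ≤ s.val := by omega
  have hjm : j < m := by omega
  have h2 : (minEdgeList w).get s = e s := h.getElem_minEdgeList s.2
  rw [h2] at hk
  have h3 : (e j).1 = (e s).2 := by rw [hje, ← hk]
  obtain ⟨i, hi, hie⟩ := h.tail_visited j hjm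
  rw [h3, h.head_new s hsm hsP] at hie
  have h4 := visitedCount_mono P hjs
  have h5 := visitedCount_mono P hsm
  rw [Nat.succ_eq_add_one, visitedCount_succ_of_notMem hsP] at h5
  have := h.injOn i (by omega) _ (by omega) hie
  omega

lemma numCycleInducing_le (h : IsExploration w P v e m) : numCycleInducing w ≤ P.card := by
  unfold numCycleInducing
  refine card_le_card_of_injOn (fun s => s.val) (fun s hs => ?_) fun _ _ _ _ h => Fin.ext h
  exact h.mem_of_isCycleInducing s (by simpa using hs)

end IsExploration

end Exploration

lemma exists_mem_zip_tail_of_mem_tail {V : Type*} {w : List V} {x : V} (h : x ∈ w.tail) :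
    ∃ y, (y, x) ∈ w.zip w.tail := by
  induction w with
  | nil => simp at h
  | cons a w ih =>
    cases w with
    | nil => simp at h
    | cons b w =>
      rcases List.mem_cons.1 h with rfl | h
      · exact ⟨a, by simp⟩
      · obtain ⟨y, hy⟩ := ih h
        exact ⟨y, by simpa using Or.inr hy⟩

lemma exists_mem_zip_tail_of_mem_dropLast {V : Type*} {w : List V} {x : V}
    (h : x ∈ w.dropLast) : ∃ y, (x, y) ∈ w.zip w.tail := by
  induction w with
  | nil => simp at h
  | cons a w ih =>
    cases w with
    | nil => simp at h
    | cons b w =>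
      rw [List.dropLast_cons_cons] at h
      rcases List.mem_cons.1 h with rfl | h
      · exact ⟨b, by simp⟩
      · obtain ⟨y, hy⟩ := ih h
        exact ⟨y, by simpa using Or.inr hy⟩

/-- Index of the tail of the `s`-th edge when the edges in `P` are cycle inducing and the edge
following `k ∈ P` starts at the vertex with index `X k`. -/
def tailIndex (P : Finset ℕ) (X : ℕ → ℕ) (s : ℕ) : ℕ :=
  if ∃ k ∈ P, k + 1 = s then X (s - 1) else visitedCount P s - 1

/-- Index of the head of the `s`-th edge when the edges in `P` are cycle inducing and the edge
`k ∈ P` ends at the vertex with index `H k`. -/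
def headIndex (P : Finset ℕ) (H : ℕ → ℕ) (s : ℕ) : ℕ :=
  if s ∈ P then H s else visitedCount P s

/-- Codes for edge lists with `n` vertices and `n + T` edges of which `T + 1` are cycle inducing:
the positions of the cycle-inducing edges (the last edge is one), the indices of their heads
(one of them is the first vertex), and the indices of the tails of the edges following them. -/
def codes (n T : ℕ) : Finset ((Fin (T + 1) → ℕ) × (Fin (T + 1) → ℕ) × (Fin (T + 1) → ℕ)) :=
  univ.biUnion fun k : Fin (T + 1) =>
    (Fintype.piFinset fun i => if i = Fin.last T then {n + T - 1} else range (n + T)) ×ˢ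
      (Fintype.piFinset fun i => if i = k then {0} else range n) ×ˢ
        (Fintype.piFinset fun i => if i = Fin.last T then {0} else range n)

lemma card_piFinset_ite_singleton {T : ℕ} (k : Fin (T + 1)) (x m : ℕ) :
    (Fintype.piFinset fun i => if i = k then {x} else range m).card = m ^ T := by
  rw [Fintype.card_piFinset, ← mul_prod_erase univ _ (mem_univ k)]
  rw [prod_congr rfl (g := fun _ => m) fun i hi => by simp [ne_of_mem_erase hi]]
  simp

lemma card_codes_le (n T : ℕ) : (codes n T).card ≤ (T + 1) * ((n + T) ^ T * (n ^ T * n ^ T)) := by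
  refine card_biUnion_le.trans ?_
  simp only [card_product, card_piFinset_ite_singleton]
  simp

section Decode

variable {V : Type*} [DecidableEq V]

/-- The function on `ℕ` extending `u` with default value `z`. -/
def extendFin {V : Type*} (z : V) {n : ℕ} (u : Fin n → V) (i : ℕ) : V :=
  if hi : i < n then u ⟨i, hi⟩ else z

/-- The edge set with vertices `u` described by a code; `z` is a default vertex. -/
def decodeEdges (z : V) {n T : ℕ}
    (c : (Fin (T + 1) → ℕ) × (Fin (T + 1) → ℕ) × (Fin (T + 1) → ℕ)) (u : Fin n → V) :
    Finset (V × V) :=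
  (range (n + T)).image fun s =>
    (extendFin z u (tailIndex (univ.image c.1) (Function.extend c.1 c.2.2 0) s),
      extendFin z u (headIndex (univ.image c.1) (Function.extend c.1 c.2.1 0) s))

/-- `D` is a digraph on the vertex set `A`, with `T` more edges than vertices, in which every
vertex has positive in-degree and positive out-degree. -/
structure IsCore (D : Finset (V × V)) (A : Finset V) (T : ℕ) : Prop where
  card_eq : D.card = A.card + T
  fst_mem : ∀ e ∈ D, e.1 ∈ A
  snd_mem : ∀ e ∈ D, e.2 ∈ A
  exists_fst : ∀ x ∈ A, ∃ e ∈ D, e.1 = x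
  exists_snd : ∀ x ∈ A, ∃ e ∈ D, e.2 = x

lemma toFinset_minEdgeList (w : List V) : (minEdgeList w).toFinset = (w.zip w.tail).toFinset := by
  ext; simp [mem_minEdgeList]

lemma card_toFinset_zip_tail (w : List V) :
    (w.zip w.tail).toFinset.card = (minEdgeList w).length := by
  rw [← toFinset_minEdgeList, List.toFinset_card_of_nodup (nodup_minEdgeList w)]

lemma isCore_toFinset {w : List V} {T : ℕ}
    (hcard : (minEdgeList w).length = w.toFinset.card + T)
    (hfirst : ∀ x ∈ w, x ∈ w.tail) (hlast : ∀ x ∈ w, x ∈ w.dropLast) :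
    IsCore (w.zip w.tail).toFinset w.toFinset T where
  card_eq := by rw [card_toFinset_zip_tail, hcard]
  fst_mem e he := List.mem_toFinset.2 (List.of_mem_zip (List.mem_toFinset.1 he)).1
  snd_mem e he := List.mem_toFinset.2
    (List.mem_of_mem_tail (List.of_mem_zip (List.mem_toFinset.1 he)).2)
  exists_fst x hx := by
    obtain ⟨y, hy⟩ := exists_mem_zip_tail_of_mem_dropLast (hlast x (List.mem_toFinset.1 hx))
    exact ⟨_, List.mem_toFinset.2 hy, rfl⟩
  exists_snd x hx := by
    obtain ⟨y, hy⟩ := exists_mem_zip_tail_of_mem_tail (hfirst x (List.mem_toFinset.1 hx))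
    exact ⟨_, List.mem_toFinset.2 hy, rfl⟩

lemma exists_code_of_isCore (z : V) {w : List V} {T : ℕ} (hne : w ≠ [])
    (hD : IsCore (w.zip w.tail).toFinset w.toFinset T) :
    ∃ n, 0 < n ∧ n + T < w.length ∧ ∃ c ∈ codes n T, ∃ u : Fin n → V, Function.Injective u ∧
      univ.image u = w.toFinset ∧ decodeEdges z c u = (w.zip w.tail).toFinset := by
  obtain ⟨l, c, rfl⟩ := List.eq_nil_or_concat' w |>.resolve_left hne
  obtain ⟨P, v, e, m, h⟩ := exists_isExploration l c
  set w := l ++ [c] with hw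
  set n := visitedCount P m with hn
  have hnpos : 0 < n := visitedCount_pos _ _
  have hmE : (w.zip w.tail).toFinset.card = m := by
    rw [card_toFinset_zip_tail, h.length_minEdgeList]
  have hm : m = n + T := by
    rw [← hmE, hD.card_eq, h.card_toFinset]
  have hPc : P.card = T + 1 := by
    have := visitedCount_add_card h.subset_range
    omega
  have hlen : n + T < w.length := by
    have h1 := length_minEdgeList_le w
    rw [h.length_minEdgeList] at h1
    have h2 : 0 < w.length := by simp [hw]
    omega
  have hP : ∀ k ∈ P, k < m := fun k hk => mem_range.1 (h.subset_range hk)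
  have hle : ∀ {s}, s ≤ m → visitedCount P s ≤ n := fun hs => visitedCount_mono P hs
  have he : ∀ z, z ∈ (w.zip w.tail).toFinset ↔ ∃ s < m, e s = z := fun z => by
    rw [← toFinset_minEdgeList, List.mem_toFinset, h.mem_minEdgeList_iff]
  have hlastP : m - 1 ∈ P := by
    rcases h.getLast c (by simp [hw]) with ⟨k, hk, rfl⟩ | ⟨-, h1⟩
    · simpa using hk
    · obtain ⟨x, hx, hxc⟩ := hD.exists_fst c (by simp [hw])
      obtain ⟨s, hs, rfl⟩ := (he x).1 hx
      exact absurd hxc (h1 s hs)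
  set p := P.orderEmbOfFin hPc with hp
  have hpmem : ∀ i, p i ∈ P := fun i => P.orderEmbOfFin_mem hPc i
  have hpinj : Function.Injective p := p.injective
  have hpim : univ.image p = P := by
    ext x
    rw [← P.mem_coe (a := x), ← P.range_orderEmbOfFin hPc]
    simp [hp]
  have hplast : p (Fin.last T) = m - 1 := by
    obtain ⟨i, hi⟩ : ∃ i, p i = m - 1 := by
      rw [← hpim] at hlastP
      simpa using hlastP
    refine le_antisymm (Nat.le_sub_one_of_lt (hP _ (hpmem _))) ?_
    rw [← hi]
    exact p.monotone (Fin.le_last i)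
  choose! H hH hHe using h.head_visited
  choose! X hX hXe using h.tail_visited
  set cd : (Fin (T + 1) → ℕ) × (Fin (T + 1) → ℕ) × (Fin (T + 1) → ℕ) :=
    (p, fun i => H (p i), fun i => if i = Fin.last T then 0 else X (p i + 1)) with hcd
  have hcode : cd ∈ codes n T := by
    obtain ⟨x, hx, hxv⟩ := hD.exists_snd (v 0)
      (List.mem_toFinset.2 ((h.mem_iff _).2 ⟨0, hnpos, rfl⟩))
    obtain ⟨s, hs, rfl⟩ := (he x).1 hx
    have hsP : s ∈ P := by
      by_contra hsP
      rw [h.head_new s hs hsP] at hxv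
      have h1 := hle (Nat.succ_le_of_lt hs)
      rw [Nat.succ_eq_add_one, visitedCount_succ_of_notMem hsP] at h1
      have := h.injOn _ (by omega) 0 hnpos hxv
      have := visitedCount_pos P s
      omega
    have hHs : H s = 0 := h.injOn _ ((hH s hsP).trans_le (hle hs.le)) 0 hnpos
      ((hHe s hsP).trans hxv)
    obtain ⟨k, rfl⟩ : ∃ k, p k = s := by
      rw [← hpim] at hsP
      simpa using hsP
    refine mem_biUnion.2 ⟨k, mem_univ _, ?_⟩
    simp only [hcd, mem_product, Fintype.mem_piFinset]
    refine ⟨fun i => ?_, fun i => ?_, fun i => ?_⟩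
    · split_ifs with hi
      · rw [hi, hplast, hm]; simp
      · rw [← hm]; exact h.subset_range (hpmem i)
    · split_ifs with hi
      · rw [hi, hHs]; simp
      · exact mem_range.2 ((hH _ (hpmem i)).trans_le (hle (hP _ (hpmem i)).le))
    · split_ifs with hi
      · simp
      · have h1 : p i ≠ m - 1 := fun h1 => hi (hpinj (h1.trans hplast.symm))
        have h2 := hP _ (hpmem i)
        have h3 : p i + 1 < m := by omega
        exact mem_range.2 ((hX _ h3).trans_le (hle h3.le))
  refine ⟨n, hnpos, hlen, cd, hcode, fun i => v i, ?_, ?_, ?_⟩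
  · intro i j hij
    exact Fin.ext (h.injOn i i.2 j j.2 hij)
  · ext x
    rw [List.mem_toFinset, h.mem_iff]
    simp only [mem_image, mem_univ, true_and]
    exact ⟨fun ⟨i, hi⟩ => ⟨i, i.2, hi⟩, fun ⟨i, hi, hx⟩ => ⟨⟨i, hi⟩, hx⟩⟩
  · have hext : ∀ i y, i < n → v i = y → extendFin z (fun i : Fin n => v i) i = y :=
      fun i y hi hy => by rw [extendFin, dif_pos hi, hy]
    have hdec : ∀ s < m,
        (extendFin z (fun i : Fin n => v i)
            (tailIndex (univ.image cd.1) (Function.extend cd.1 cd.2.2 0) s),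
          extendFin z (fun i : Fin n => v i)
            (headIndex (univ.image cd.1) (Function.extend cd.1 cd.2.1 0) s)) = e s := by
      intro s hs
      have hc1 : univ.image cd.1 = P := hpim
      rw [hc1]
      refine Prod.ext ?_ ?_
      · simp only [tailIndex]
        split_ifs with hk
        · obtain ⟨k, hk, rfl⟩ := hk
          obtain ⟨i, rfl⟩ : ∃ i, p i = k := by
            rw [← hpim] at hk
            simpa using hk
          have hi : i ≠ Fin.last T := by
            rintro rfl
            omega
          have : Function.extend cd.1 cd.2.2 0 (p i + 1 - 1) = X (p i + 1) := by
            rw [Nat.add_sub_cancel]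
            refine (hpinj.extend_apply _ _ i).trans ?_
            simp [hcd, hi]
          rw [this]
          exact hext _ _ ((hX _ hs).trans_le (hle hs.le)) (hXe _ hs)
        · have hk' : ∀ k ∈ P, k + 1 ≠ s := fun k hkP hks => hk ⟨k, hkP, hks⟩
          have := visitedCount_pos P s
          have := hle hs.le
          exact hext _ _ (by omega) (h.tail_eq s hs hk').symm
      · simp only [headIndex]
        split_ifs with hk
        · obtain ⟨i, rfl⟩ : ∃ i, p i = s := by
            rw [← hpim] at hk
            simpa using hk
          have : Function.extend cd.1 cd.2.1 0 (p i) = H (p i) := hpinj.extend_apply _ _ i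
          rw [this]
          exact hext _ _ ((hH _ hk).trans_le (hle hs.le)) (hHe _ hk)
        · have h1 := hle (Nat.succ_le_of_lt hs)
          rw [Nat.succ_eq_add_one, visitedCount_succ_of_notMem hk] at h1
          exact hext _ _ (by omega) (h.head_new s hs hk).symm
    ext x
    rw [he, decodeEdges, ← hm, mem_image]
    constructor
    · rintro ⟨s, hs, rfl⟩
      exact ⟨s, mem_range.1 hs, (hdec s (mem_range.1 hs)).symm⟩
    · rintro ⟨s, hs, rfl⟩
      exact ⟨s, mem_range.2 hs, hdec s hs⟩

lemma exists_infix_isCore {T : ℕ} (w : List V)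
    (hw : w.toFinset.card + T ≤ (minEdgeList w).length) (hpos : w ≠ []) :
    ∃ w', w' <:+: w ∧ w' ≠ [] ∧ IsCore (w'.zip w'.tail).toFinset w'.toFinset T := by
  induction hk : w.length using Nat.strong_induction_on generalizing w with
  | _ k ih =>
  subst hk
  by_cases hfirst : ∀ x ∈ w, x ∈ w.tail
  swap
  · obtain ⟨x, l, rfl⟩ := List.exists_cons_of_ne_nil hpos
    have hx : x ∉ l := by
      intro hx
      refine hfirst fun y hy => ?_
      rcases List.mem_cons.1 hy with rfl | hy
      · exact hx
      · exact hy
    cases l with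
    | nil => simp [minEdgeList] at hw
    | cons y l =>
      have h1 : (x :: y :: l).toFinset.card = (y :: l).toFinset.card + 1 := by
        rw [List.toFinset_cons, card_insert_of_notMem (by simpa using hx)]
      have h2 : (minEdgeList (x :: y :: l)).length ≤ (minEdgeList (y :: l)).length + 1 := by
        rw [← card_toFinset_zip_tail, ← card_toFinset_zip_tail, List.tail_cons,
          List.zip_cons_cons, List.toFinset_cons]
        exact card_insert_le _ _
      obtain ⟨w', h3, h4⟩ := ih _ (by simp) (y :: l) (by omega) (by simp) rfl
      exact ⟨w', h3.trans (List.suffix_cons _ _).isInfix, h4⟩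
  obtain ⟨l, c, rfl⟩ := List.eq_nil_or_concat' w |>.resolve_left hpos
  obtain ⟨l, x, rfl⟩ : ∃ l' x, l = l' ++ [x] := by
    refine List.eq_nil_or_concat' l |>.resolve_left ?_
    rintro rfl
    simp [minEdgeList] at hw
  have h2 : (minEdgeList (l ++ [x] ++ [c])).length ≤ (minEdgeList (l ++ [x])).length + 1 := by
    by_cases hc : (x, c) ∈ minEdgeList (l ++ [x])
    · rw [minEdgeList_concat_of_mem hc]; omega
    · rw [minEdgeList_concat_of_notMem hc]; simp
  by_cases hdrop : (l ++ [x]).toFinset.card + T ≤ (minEdgeList (l ++ [x])).length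
  · obtain ⟨w', h3, h4⟩ := ih _ (by simp) (l ++ [x]) hdrop (by simp) rfl
    exact ⟨w', h3.trans (List.prefix_append _ _).isInfix, h4⟩
  have h1 : (l ++ [x] ++ [c]).toFinset = insert c (l ++ [x]).toFinset := by
    ext; simp [or_left_comm]
  have hc : c ∈ l ++ [x] := by
    by_contra hc
    rw [h1, card_insert_of_notMem (mt List.mem_toFinset.1 hc)] at hw
    omega
  rw [insert_eq_of_mem (List.mem_toFinset.2 hc)] at h1
  rw [h1] at hw
  refine ⟨_, List.infix_rfl, hpos, isCore_toFinset (by rw [h1]; omega) hfirst fun y hy => ?_⟩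
  rw [List.dropLast_concat]
  rcases List.mem_append.1 hy with hy | hy
  · exact hy
  · rwa [List.mem_singleton.1 hy]

/-- A walk with more than `T` cycle-inducing edges contains the edges of a core described by
a code. -/
lemma exists_code_of_lt_numCycleInducing (r : V → V → Prop) (z : V) {T : ℕ} {w : List V}
    (hr : w.IsChain r) (hw : T < numCycleInducing w) :
    ∃ n, 0 < n ∧ n + T < w.length ∧ ∃ c ∈ codes n T, ∃ u : Fin n → V, Function.Injective u ∧
      IsCore (decodeEdges z c u) (univ.image u) T ∧ ∀ e ∈ decodeEdges z c u, r e.1 e.2 := by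
  have hne : w ≠ [] := by
    rintro rfl
    have h0 : numCycleInducing ([] : List V) ≤ 0 := (card_le_univ _).trans (by simp [minEdgeList])
    omega
  have hcard : w.toFinset.card + T ≤ (minEdgeList w).length := by
    obtain ⟨l, c, rfl⟩ := List.eq_nil_or_concat' w |>.resolve_left hne
    obtain ⟨P, v, e, m, h⟩ := exists_isExploration l c
    have h1 := h.numCycleInducing_le
    have h2 := visitedCount_add_card h.subset_range
    rw [h.card_toFinset, h.length_minEdgeList]
    omega
  obtain ⟨w', hinf, hne', hcore⟩ := exists_infix_isCore w hcard hne
  obtain ⟨n, hn, hlen, c, hc, u, hu, hA, hD⟩ := exists_code_of_isCore z hne' hcore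
  refine ⟨n, hn, hlen.trans_le hinf.length_le, c, hc, u, hu, by rwa [hA, hD], ?_⟩
  rw [hD]
  intro e he
  have hr' := List.isChain_iff_getElem.1 (hr.infix hinf)
  obtain ⟨i, hi, rfl⟩ := List.mem_iff_getElem.1 (List.mem_toFinset.1 he)
  simp only [List.length_zip, List.length_tail] at hi
  simpa using hr' i (by omega)

end Decode

section Probability

variable {N : ℕ} {p : Fin N → Fin N → ℝ}

lemma configProb_nonneg (h0 : ∀ i j, 0 ≤ p i j) (h1 : ∀ i j, p i j ≤ 1)
    (ω : Fin N → Fin N → Bool) : 0 ≤ configProb N p ω :=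
  prod_nonneg fun i _ => prod_nonneg fun j _ => by
    split_ifs
    · exact h0 i j
    · exact sub_nonneg.2 (h1 i j)

lemma sum_prod_prod_apply (g : Fin N → Fin N → Bool → ℝ) :
    ∑ ω : Fin N → Fin N → Bool, ∏ i, ∏ j, g i j (ω i j) =
      ∏ i, ∏ j, (g i j true + g i j false) := by
  have h (i : Fin N) : ∏ j, (g i j true + g i j false) =
      ∑ r : Fin N → Bool, ∏ j, g i j (r j) := by
    rw [← Fintype.prod_sum]
    simp
  simp_rw [h]
  rw [Fintype.prod_sum]

lemma sum_configProb (N : ℕ) (p : Fin N → Fin N → ℝ) : ∑ ω, configProb N p ω = 1 := by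
  unfold configProb
  rw [sum_prod_prod_apply fun i j x => if x then p i j else 1 - p i j]
  simp

lemma prEvent_add_prEvent_not (E : (Fin N → Fin N → Bool) → Prop) :
    prEvent N p E + prEvent N p (fun ω => ¬ E ω) = 1 := by
  rw [← sum_configProb N p, prEvent, prEvent, ← sum_add_distrib]
  refine sum_congr rfl fun ω _ => ?_
  by_cases h : E ω <;> simp [h]

lemma prEvent_forall_mem (D : Finset (Fin N × Fin N)) :
    prEvent N p (fun ω => ∀ e ∈ D, ω e.1 e.2 = true) = ∏ e ∈ D, p e.1 e.2 := by
  let g (i j : Fin N) (x : Bool) : ℝ :=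
    if x = true then p i j else if (i, j) ∈ D then 0 else 1 - p i j
  have h : prEvent N p (fun ω => ∀ e ∈ D, ω e.1 e.2 = true) =
      ∑ ω : Fin N → Fin N → Bool, ∏ i, ∏ j, g i j (ω i j) := by
    refine sum_congr rfl fun ω _ => ?_
    split_ifs with hω
    · refine prod_congr rfl fun i _ => prod_congr rfl fun j _ => ?_
      by_cases hx : ω i j = true
      · simp [g, hx]
      · have : (i, j) ∉ D := fun hD => hx (hω _ hD)
        simp [g, hx, this]
    · push Not at hω
      obtain ⟨e, he, hωe⟩ := hω
      refine (prod_eq_zero (mem_univ e.1) (prod_eq_zero (mem_univ e.2) ?_)).symm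
      simp [g, hωe, he]
  rw [h, sum_prod_prod_apply g, ← Fintype.prod_prod_type', ← prod_subset (subset_univ D)]
  · exact prod_congr rfl fun e he => by simp [g, he]
  · intro e _ he
    simp [g, he]

lemma prEvent_le_sum (h0 : ∀ i j, 0 ≤ p i j) (h1 : ∀ i j, p i j ≤ 1) {ι : Type*} (s : Finset ι)
    (E : (Fin N → Fin N → Bool) → Prop) (F : ι → (Fin N → Fin N → Bool) → Prop)
    (h : ∀ ω, E ω → ∃ i ∈ s, F i ω) : prEvent N p E ≤ ∑ i ∈ s, prEvent N p (F i) := by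
  unfold prEvent
  rw [sum_comm]
  refine sum_le_sum fun ω _ => ?_
  have hnn : ∀ i ∈ s, 0 ≤ if F i ω then configProb N p ω else 0 := fun i _ => by
    split_ifs
    · exact configProb_nonneg h0 h1 ω
    · exact le_rfl
  split_ifs with hE
  · obtain ⟨i, hi, hF⟩ := h ω hE
    calc configProb N p ω = if F i ω then configProb N p ω else 0 := by rw [if_pos hF]
      _ ≤ _ := single_le_sum hnn hi
  · exact sum_nonneg hnn

lemma prEvent_const_and_le {q : Prop} {x : ℝ} (hx : 0 ≤ x)
    (E : (Fin N → Fin N → Bool) → Prop) (h : q → prEvent N p E ≤ x) :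
    prEvent N p (fun ω => q ∧ E ω) ≤ x := by
  by_cases hq : q
  · simpa [hq] using h hq
  · simpa [hq, prEvent] using hx

end Probability

section Weight

variable {V : Type*}

lemma prod_le_prod_mul_pow_of_surj {α : Type*} [DecidableEq α] [Nonempty α] {D : Finset α}
    {A : Finset V} {T : ℕ} (hcard : D.card = A.card + T) (g : α → V)
    (hg : ∀ x ∈ A, ∃ e ∈ D, g e = x) {f : V → ℝ} (hf : ∀ x, 0 ≤ f x) {M : ℝ} (hM : ∀ x, f x ≤ M) :
    ∏ e ∈ D, f (g e) ≤ (∏ x ∈ A, f x) * M ^ T := by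
  choose! o hoD hog using hg
  have hinj : Set.InjOn o A := fun x hx y hy hxy => by
    rw [← hog x hx, ← hog y hy, hxy]
  have hsub : A.image o ⊆ D := image_subset_iff.2 hoD
  rw [← prod_sdiff hsub, mul_comm, prod_image hinj]
  have h1 : ∏ x ∈ A, f (g (o x)) = ∏ x ∈ A, f x :=
    prod_congr rfl fun x hx => by rw [hog x hx]
  have h2 : (D \ A.image o).card = T := by
    rw [card_sdiff_of_subset hsub, card_image_of_injOn hinj]; omega
  rw [h1]
  refine mul_le_mul_of_nonneg_left ?_ (prod_nonneg fun x _ => hf x)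
  calc ∏ e ∈ D \ A.image o, f (g e) ≤ ∏ e ∈ D \ A.image o, M :=
        prod_le_prod (fun _ _ => hf _) fun _ _ => hM _
    _ = M ^ T := by rw [prod_const, h2]

/-- Bound for the product of the edge probabilities over a core. -/
lemma IsCore.prod_le [DecidableEq V] [Finite V] [Nonempty V] {D : Finset (V × V)}
    {A : Finset V} {T : ℕ} (h : IsCore D A T) {a b : V → ℝ} (ha : ∀ i, 0 ≤ a i)
    (hb : ∀ i, 0 ≤ b i) {S q : ℝ} (hS : 0 < S) (hq : ∀ i j, b i * a j / S ≤ q) :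
    ∏ e ∈ D, b e.1 * a e.2 / S ≤ q ^ T * ∏ x ∈ A, a x * b x / S := by
  obtain ⟨i, hi⟩ := Finite.exists_max b
  obtain ⟨j, hj⟩ := Finite.exists_max a
  have h1 := prod_le_prod_mul_pow_of_surj h.card_eq Prod.fst h.exists_fst hb hi
  have h2 := prod_le_prod_mul_pow_of_surj h.card_eq Prod.snd h.exists_snd ha hj
  have hA : ∀ {f : V → ℝ}, (∀ x, 0 ≤ f x) → 0 ≤ ∏ x ∈ A, f x := fun hf =>
    prod_nonneg fun x _ => hf x
  calc ∏ e ∈ D, b e.1 * a e.2 / S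
      = (∏ e ∈ D, b e.1) * (∏ e ∈ D, a e.2) / S ^ (A.card + T) := by
        rw [prod_div_distrib, prod_mul_distrib, prod_const, h.card_eq]
    _ ≤ ((∏ x ∈ A, b x) * b i ^ T) * ((∏ x ∈ A, a x) * a j ^ T) / S ^ (A.card + T) := by
        refine div_le_div_of_nonneg_right ?_ (by positivity)
        exact mul_le_mul h1 h2 (prod_nonneg fun _ _ => ha _)
          (mul_nonneg (hA hb) (pow_nonneg (hb i) _))
    _ = (b i * a j / S) ^ T * ∏ x ∈ A, a x * b x / S := by
        rw [prod_div_distrib, prod_mul_distrib, prod_const, pow_add, div_pow, mul_pow]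
        field_simp
    _ ≤ q ^ T * ∏ x ∈ A, a x * b x / S := by
        refine mul_le_mul_of_nonneg_right ?_
          (hA fun x => div_nonneg (mul_nonneg (ha x) (hb x)) hS.le)
        exact pow_le_pow_left₀ (div_nonneg (mul_nonneg (hb i) (ha j)) hS.le) (hq i j) T

end Weight

/-- Bound for the probability that some walk of length at most `K` has more than `T` cycle-inducing edges. -/
lemma prEvent_exists_walk_le {N : ℕ} (hN : 0 < N) {a b : Fin N → ℝ} (ha : ∀ i, 0 ≤ a i)
    (hb : ∀ i, 0 ≤ b i) {S q : ℝ} (hS : 0 < S) (hmax : ∀ i j, b i * a j / S ≤ 1)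
    (hq : ∀ i j, b i * a j / S ≤ q) (T K : ℕ) (hd : 1 ≤ (∑ i, a i * b i) / S) :
    prEvent N (fun i j => b i * a j / S) (fun ω => ∃ w : List (Fin N),
        w.IsChain (fun u v => ω u v = true) ∧ w.length ≤ K + 1 ∧ T < numCycleInducing w) ≤
      (T + 1) * K ^ (3 * T + 1) * q ^ T * ((∑ i, a i * b i) / S) ^ K := by
  set d := (∑ i, a i * b i) / S with hd_def
  have : Nonempty (Fin N) := ⟨⟨0, hN⟩⟩
  let z : Fin N := ⟨0, hN⟩
  have hp0 : ∀ i j, 0 ≤ b i * a j / S := fun i j => div_nonneg (mul_nonneg (hb i) (ha j)) hS.le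
  have hq0 : 0 ≤ q := (hp0 z z).trans (hq z z)
  have hab : ∀ i, 0 ≤ a i * b i / S := fun i => div_nonneg (mul_nonneg (ha i) (hb i)) hS.le
  let F (n : ℕ) (c : (Fin (T + 1) → ℕ) × (Fin (T + 1) → ℕ) × (Fin (T + 1) → ℕ))
      (u : Fin n → Fin N) (ω : Fin N → Fin N → Bool) : Prop :=
    (Function.Injective u ∧ IsCore (decodeEdges z c u) (univ.image u) T) ∧
      ∀ e ∈ decodeEdges z c u, ω e.1 e.2 = true
  have hF (n) (c) (u : Fin n → Fin N) : prEvent N (fun i j => b i * a j / S) (F n c u) ≤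
      q ^ T * ∏ i, a (u i) * b (u i) / S := by
    refine prEvent_const_and_le
      (mul_nonneg (pow_nonneg hq0 _) (prod_nonneg fun i _ => hab _)) _ fun ⟨hu, hcore⟩ => ?_
    rw [prEvent_forall_mem]
    refine (hcore.prod_le ha hb hS hq).trans_eq ?_
    rw [prod_image hu.injOn]
  have hsum (n : ℕ) : ∑ u : Fin n → Fin N, q ^ T * ∏ i, a (u i) * b (u i) / S = q ^ T * d ^ n := by
    rw [← mul_sum, ← Fintype.sum_pow (fun i => a i * b i / S), ← sum_div]
  have hn (n : ℕ) : prEvent N (fun i j => b i * a j / S)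
      (fun ω => n + T ≤ K ∧ ∃ c ∈ codes n T, ∃ u ∈ univ, F n c u ω) ≤
        (T + 1) * K ^ (3 * T) * (q ^ T * d ^ K) := by
    refine prEvent_const_and_le (by positivity) _ fun hnK => ?_
    calc _ ≤ ∑ c ∈ codes n T, prEvent N (fun i j => b i * a j / S)
          (fun ω => ∃ u ∈ univ, F n c u ω) := prEvent_le_sum hp0 hmax _ _ _ fun _ h => h
      _ ≤ ∑ c ∈ codes n T, q ^ T * d ^ n := by
          refine sum_le_sum fun c _ => ?_
          rw [← hsum n]
          exact (prEvent_le_sum hp0 hmax univ _ (F n c) fun _ h => h).trans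
            (sum_le_sum fun u _ => hF n c u)
      _ = (codes n T).card * (q ^ T * d ^ n) := by rw [sum_const, nsmul_eq_mul]
      _ ≤ (T + 1) * K ^ (3 * T) * (q ^ T * d ^ K) := by
          have hc : (codes n T).card ≤ (T + 1) * K ^ (3 * T) := by
            refine (card_codes_le n T).trans (Nat.mul_le_mul_left _ ?_)
            calc (n + T) ^ T * (n ^ T * n ^ T) ≤ K ^ T * (K ^ T * K ^ T) := by
                  gcongr <;> omega
              _ = K ^ (3 * T) := by ring
          have hc' : ((codes n T).card : ℝ) ≤ (T + 1) * K ^ (3 * T) := by exact_mod_cast hc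
          gcongr
          omega
  calc _ ≤ ∑ n ∈ Icc 1 K, prEvent N (fun i j => b i * a j / S)
          (fun ω => n + T ≤ K ∧ ∃ c ∈ codes n T, ∃ u ∈ univ, F n c u ω) := by
        refine prEvent_le_sum hp0 hmax _ _ _ ?_
        rintro ω ⟨w, hw, hlen, hT⟩
        obtain ⟨n, hn0, hnw, c, hc, u, hu, hcore, hω⟩ :=
          exists_code_of_lt_numCycleInducing (fun u v => ω u v = true) z hw hT
        exact ⟨n, mem_Icc.2 ⟨hn0, by omega⟩, by omega, c, hc, u, mem_univ u, ⟨hu, hcore⟩, hω⟩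
    _ ≤ ∑ n ∈ Icc 1 K, (T + 1) * K ^ (3 * T) * (q ^ T * d ^ K) := sum_le_sum fun n _ => hn n
    _ = _ := by
        rw [sum_const, Nat.card_Icc, nsmul_eq_mul, Nat.add_sub_cancel]
        ring

/-- In the directed Chung-Lu model with `p_max ≤ R/N^τ` and `a·b/S > 1`, for `t ≥ 2`,
with probability at least `1 - t R^(t-1) (L+1)^(3t-2) / N^((t-1)τ/2)`, every present walk of
length at most `L = ((t-1)τ/2) log_{a·b/S} N` has fewer than `t` cycle-inducing edges. -/
theorem few_cycle_inducing_edges_whp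
    (N : ℕ) (hN : 0 < N) (a b : Fin N → ℝ) (ha : ∀ i, 0 ≤ a i) (hb : ∀ i, 0 ≤ b i)
    (S : ℝ) (hS : 0 < S) (hSa : ∑ i, a i = S) (hSb : ∑ i, b i = S)
    (hmax : ∀ i j, a i * b j ≤ S)
    (pmax : ℝ) (hpmax : IsGreatest {x : ℝ | ∃ i j, x = b i * a j / S} pmax)
    (hd : 1 < (∑ i, a i * b i) / S)
    (R τ : ℝ) (hR : 0 < R) (hτ : 0 < τ)
    (hpR : pmax ≤ R / (N : ℝ) ^ τ)
    (t : ℕ) (ht : 2 ≤ t) :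
    1 - (t : ℝ) * R ^ (t - 1) *
          (((t : ℝ) - 1) * τ / 2 * Real.logb ((∑ i, a i * b i) / S) N + 1) ^ (3 * t - 2) /
          (N : ℝ) ^ (((t : ℝ) - 1) * τ / 2) ≤
      prEvent N (fun i j => b i * a j / S)
        (fun ω => ∀ w : List (Fin N),
          w.Chain' (fun u v => ω u v = true) →
          (w.length : ℝ) - 1 ≤ ((t : ℝ) - 1) * τ / 2 * Real.logb ((∑ i, a i * b i) / S) N →
          numCycleInducing w < t) := by
  obtain ⟨T, rfl⟩ : ∃ T, t = T + 1 := ⟨t - 1, by omega⟩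
  set d := (∑ i, a i * b i) / S with hd_def
  have hNR : (1 : ℝ) ≤ N := by exact_mod_cast hN
  have hT : ((T + 1 : ℕ) : ℝ) - 1 = T := by push_cast; ring
  rw [hT]
  set L := (T : ℝ) * τ / 2 * Real.logb d N with hL
  have hlog : 0 ≤ Real.logb d N := Real.logb_nonneg hd hNR
  have hL0 : 0 ≤ L := by positivity
  have hd0 : 0 < d := by linarith
  have hdL : d ^ L = (N : ℝ) ^ ((T : ℝ) * τ / 2) := by
    rw [hL, mul_comm, Real.rpow_mul hd0.le, Real.rpow_logb hd0 hd.ne' (by linarith)]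
  set M := (N : ℝ) ^ ((T : ℝ) * τ / 2) with hM
  have hMpos : 0 < M := by positivity
  have hMsq : ((N : ℝ) ^ τ) ^ T = M * M := by
    rw [hM, ← Real.rpow_add (by linarith), ← Real.rpow_natCast, ← Real.rpow_mul (by linarith)]
    congr 1
    ring
  have hp1 : ∀ i j, b i * a j / S ≤ 1 := fun i j => by
    rw [div_le_one hS, mul_comm]; exact hmax j i
  have hq : ∀ i j, b i * a j / S ≤ R / (N : ℝ) ^ τ := fun i j => (hpmax.2 ⟨i, j, rfl⟩).trans hpR
  have hbad := prEvent_exists_walk_le hN ha hb hS hp1 hq T ⌊L⌋₊ hd.le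
  rw [← hd_def] at hbad
  have hK : (⌊L⌋₊ : ℝ) ≤ L + 1 := (Nat.floor_le hL0).trans (by linarith)
  have hdK : d ^ ⌊L⌋₊ ≤ M := by
    rw [← hdL, ← Real.rpow_natCast]
    exact Real.rpow_le_rpow_of_exponent_le hd.le (Nat.floor_le hL0)
  have hbound : ((T : ℝ) + 1) * (⌊L⌋₊ : ℝ) ^ (3 * T + 1) * (R / (N : ℝ) ^ τ) ^ T * d ^ ⌊L⌋₊ ≤
      ((T + 1 : ℕ) : ℝ) * R ^ (T + 1 - 1) * (L + 1) ^ (3 * (T + 1) - 2) / M := by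
    calc _ ≤ ((T : ℝ) + 1) * (L + 1) ^ (3 * T + 1) * (R / (N : ℝ) ^ τ) ^ T * M := by gcongr
      _ = _ := by
        rw [div_pow, hMsq, show 3 * (T + 1) - 2 = 3 * T + 1 by omega, Nat.add_sub_cancel]
        push_cast
        field_simp
  have hcompl := prEvent_add_prEvent_not (p := fun i j => b i * a j / S)
    (fun ω => ∃ w : List (Fin N), w.IsChain (fun u v => ω u v = true) ∧
      w.length ≤ ⌊L⌋₊ + 1 ∧ T < numCycleInducing w)
  have hgood : (fun ω : Fin N → Fin N → Bool => ¬ ∃ w : List (Fin N),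
      w.IsChain (fun u v => ω u v = true) ∧ w.length ≤ ⌊L⌋₊ + 1 ∧ T < numCycleInducing w) =
      fun ω => ∀ w : List (Fin N), w.IsChain (fun u v => ω u v = true) →
        (w.length : ℝ) - 1 ≤ L → numCycleInducing w < T + 1 := by
    funext ω
    have hlen (w : List (Fin N)) : w.length ≤ ⌊L⌋₊ + 1 ↔ (w.length : ℝ) - 1 ≤ L := by
      rw [← Nat.sub_le_iff_le_add, Nat.le_floor_iff hL0]
      rcases Nat.eq_zero_or_pos w.length with h | h
      · simp only [h]; norm_num; exact ⟨fun _ => by linarith, fun _ => hL0⟩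
      · rw [Nat.cast_sub h, Nat.cast_one]
    push Not
    simp only [hlen, Nat.lt_succ_iff]
  rw [hgood] at hcompl
  change _ ≤ prEvent N (fun i j => b i * a j / S) (fun ω => ∀ w : List (Fin N),
    w.IsChain (fun u v => ω u v = true) → (w.length : ℝ) - 1 ≤ L → numCycleInducing w < T + 1)
  linarith
end
end

section
/- Let l, m, r be natural numbers with 1 ≤ l ≤ m, and let α, β be real numbers with α ≥ 0 and 0 ≤ β < 1. Then ∑ binom(k₀ + k₁ + ⋯ + k_m; k₀, k₁, …, k_m) · (∏_{i=1}^{l} α^{k_i}) · (∏_{i=l+1}^{m} α^{k_i}·β^{(i−l)·k_i}) ≤ exp( l·r·α/(1−β) ), where the sum ranges over all tuples (k₀, k₁, …, k_m) of integers with 0 ≤ k_i ≤ r for every i and k₀ + ∑_{i=1}^{m} i·k_i = r, and binom(∑ k_i; k₀, …, k_m) denotes the multinomial coefficient (∑_{i=0}^{m} k_i)! / (k₀!·k₁!·⋯·k_m!). -/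
open Finset

noncomputable section
open scoped Classical

/-- The coefficient of `X ^ r` in the `n`-th power of `∑ i, v i * X ^ d i`, by the multinomial
theorem. -/
theorem coeff_sum_monomial_pow {ι : Type*} [Fintype ι] [DecidableEq ι] (d : ι → ℕ) (v : ι → ℝ)
    (n r : ℕ) :
    ((∑ i, Polynomial.monomial (d i) (v i)) ^ n).coeff r =
      ∑ k ∈ (Finset.piAntidiag Finset.univ n).filter (fun k : ι → ℕ => ∑ i, d i * k i = r),
        (Nat.multinomial Finset.univ k : ℝ) * ∏ i, v i ^ k i := by
  have h (k : ι → ℕ) : ∏ i, Polynomial.monomial (d i) (v i) ^ k i =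
      Polynomial.monomial (∑ i, d i * k i) (∏ i, v i ^ k i) := by
    simp only [← Polynomial.C_mul_X_pow_eq_monomial, mul_pow, ← pow_mul, map_pow,
      Finset.prod_mul_distrib, Finset.prod_pow_eq_pow_sum, map_prod]
  rw [Finset.sum_pow_eq_sum_piAntidiag, Polynomial.finsetSum_coeff, Finset.sum_filter]
  refine Finset.sum_congr rfl fun k _ => ?_
  rw [h, ← Polynomial.C_eq_natCast, Polynomial.coeff_C_mul, Polynomial.coeff_monomial]
  simp only [mul_ite, mul_zero]

/-- If `v ≥ 0` has sum at least `1` and all `d i` are positive, then the coefficient of `X ^ r` in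
`∑ n < N, (∑ i, v i * X ^ d i) ^ n` is at most `(∑ i, v i) ^ r`. -/
theorem sum_coeff_sum_monomial_pow_le {ι : Type*} [Fintype ι] (d : ι → ℕ) (v : ι → ℝ)
    (hd : ∀ i, 1 ≤ d i) (hv : ∀ i, 0 ≤ v i) (h1 : 1 ≤ ∑ i, v i) (N r : ℕ) :
    ∑ n ∈ Finset.range N, ((∑ i, Polynomial.monomial (d i) (v i)) ^ n).coeff r ≤
      (∑ i, v i) ^ r := by
  induction N generalizing r with
  | zero => simpa using pow_nonneg (zero_le_one.trans h1) r
  | succ N ih =>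
    have hstep (n : ℕ) : ((∑ i, Polynomial.monomial (d i) (v i)) ^ (n + 1)).coeff r =
        ∑ i, if d i ≤ r then
          v i * ((∑ i, Polynomial.monomial (d i) (v i)) ^ n).coeff (r - d i) else 0 := by
      rw [pow_succ', Finset.sum_mul, Polynomial.finsetSum_coeff]
      refine Finset.sum_congr rfl fun i _ => ?_
      rw [← Polynomial.C_mul_X_pow_eq_monomial, mul_assoc, Polynomial.coeff_C_mul,
        Polynomial.coeff_X_pow_mul']
      simp only [mul_ite, mul_zero]
    rw [Finset.sum_range_succ']
    simp only [hstep, pow_zero, Polynomial.coeff_one]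
    rw [Finset.sum_comm]
    rcases r with _ | r
    · have hd0 (i : ι) : ¬ d i ≤ 0 := by have := hd i; omega
      simp [hd0]
    · have hterm (i : ι) : (∑ n ∈ Finset.range N, if d i ≤ r + 1 then
          v i * ((∑ i, Polynomial.monomial (d i) (v i)) ^ n).coeff (r + 1 - d i) else 0) ≤
          v i * (∑ i, v i) ^ r := by
        split_ifs
        · rw [← Finset.mul_sum]
          refine mul_le_mul_of_nonneg_left ((ih _).trans (pow_le_pow_right₀ h1 ?_)) (hv i)
          have := hd i
          omega
        · simpa using mul_nonneg (hv i) (pow_nonneg (zero_le_one.trans h1) r)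
      simpa [pow_succ', Finset.sum_mul] using Finset.sum_le_sum fun i _ => hterm i

/-- A sum of weighted multinomial coefficients over tuples of weighted degree `r` is at most the
`r`-th power of the total weight, if the latter is at least `1`. -/
theorem sum_multinomial_mul_prod_pow_le {ι : Type*} [Fintype ι] (d : ι → ℕ) (v : ι → ℝ)
    (hd : ∀ i, 1 ≤ d i) (hv : ∀ i, 0 ≤ v i) (h1 : 1 ≤ ∑ i, v i) (r : ℕ)
    (s : Finset (ι → ℕ)) (hs : ∀ k ∈ s, ∑ i, d i * k i = r) :
    ∑ k ∈ s, (Nat.multinomial Finset.univ k : ℝ) * ∏ i, v i ^ k i ≤ (∑ i, v i) ^ r := by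
  refine le_trans ?_ (sum_coeff_sum_monomial_pow_le d v hd hv h1 (r + 1) r)
  have hmaps : ∀ k ∈ s, ∑ i, k i ∈ Finset.range (r + 1) := fun k hk => by
    rw [Finset.mem_range, Nat.lt_succ_iff, ← hs k hk]
    exact Finset.sum_le_sum fun i _ => Nat.le_mul_of_pos_left _ (hd i)
  rw [← Finset.sum_fiberwise_of_maps_to hmaps]
  refine Finset.sum_le_sum fun n _ => ?_
  rw [coeff_sum_monomial_pow]
  refine Finset.sum_le_sum_of_subset_of_nonneg (fun k hk => ?_) fun k _ _ =>
    mul_nonneg (Nat.cast_nonneg _) (Finset.prod_nonneg fun i _ => pow_nonneg (hv i) _)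
  rw [Finset.mem_filter] at hk
  simp [Finset.mem_piAntidiag, hk.2, hs k hk.1]

/-- The weights `1` (for `i < l`) followed by `β, β², …` have sum at most `l / (1 - β)`. -/
theorem sum_range_truncated_geometric_le (l m : ℕ) (hl : 1 ≤ l) (hlm : l ≤ m)
    (β : ℝ) (hβ0 : 0 ≤ β) (hβ1 : β < 1) :
    ∑ i ∈ Finset.range m, β ^ (i + 1 - l) ≤ (l : ℝ) / (1 - β) := by
  obtain ⟨t, rfl⟩ := Nat.exists_eq_add_of_le hlm
  have h0 : 0 < 1 - β := sub_pos.2 hβ1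
  have hhead : ∑ i ∈ Finset.range l, β ^ (i + 1 - l) = l := by
    rw [Finset.sum_congr rfl fun i hi => ?_, Finset.sum_const, Finset.card_range, nsmul_one]
    rw [Nat.sub_eq_zero_of_le (Finset.mem_range.1 hi), pow_zero]
  have htail : ∑ j ∈ Finset.range t, β ^ (l + j + 1 - l) = β * ∑ j ∈ Finset.range t, β ^ j := by
    rw [Finset.mul_sum]
    refine Finset.sum_congr rfl fun j _ => ?_
    rw [show l + j + 1 - l = j + 1 by omega, pow_succ']
  have hgeom := geom_sum_mul_neg β t
  have hpow : 0 ≤ β ^ t := pow_nonneg hβ0 t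
  have hl' : (1 : ℝ) ≤ l := by exact_mod_cast hl
  rw [Finset.sum_range_add, hhead, htail, le_div_iff₀ h0]
  nlinarith [mul_nonneg hβ0 hpow, mul_nonneg hβ0 (sub_nonneg.2 hl')]

/-- For `1 ≤ l ≤ m`, `α ≥ 0` and `0 ≤ β < 1`, the sum over all tuples `(k₀, …, k_m)` with
`0 ≤ k_i ≤ r` and `k₀ + ∑_{i=1}^m i k_i = r` of the multinomial coefficients weighted by
`∏_{i=1}^l α^{k_i} ∏_{i=l+1}^m α^{k_i} β^{(i-l) k_i}` is at most `exp(l r α/(1-β))`. -/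
theorem multinomial_geometric_sum_le
    (l m r : ℕ) (hl : 1 ≤ l) (hlm : l ≤ m)
    (α β : ℝ) (hα : 0 ≤ α) (hβ0 : 0 ≤ β) (hβ1 : β < 1) :
    (∑ k ∈ (Fintype.piFinset fun _ : Fin (m + 1) => Finset.range (r + 1)).filter
        (fun k : Fin (m + 1) → ℕ =>
          k 0 + ∑ i ∈ Finset.univ.filter (fun i : Fin (m + 1) => 1 ≤ (i : ℕ)),
            (i : ℕ) * k i = r),
      (Nat.multinomial Finset.univ k : ℝ) *
        (∏ i ∈ Finset.univ.filter (fun i : Fin (m + 1) => 1 ≤ (i : ℕ) ∧ (i : ℕ) ≤ l),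
          α ^ k i) *
        (∏ i ∈ Finset.univ.filter (fun i : Fin (m + 1) => l + 1 ≤ (i : ℕ)),
          α ^ k i * β ^ (((i : ℕ) - l) * k i))) ≤
      Real.exp ((l : ℝ) * (r : ℝ) * α / (1 - β)) := by
  set v : Fin (m + 1) → ℝ := fun i => if (i : ℕ) = 0 then 1 else α * β ^ ((i : ℕ) - l) with hvdef
  set d : Fin (m + 1) → ℕ := fun i => if (i : ℕ) = 0 then 1 else i with hddef
  have hsum : ∑ i, v i = 1 + α * ∑ i ∈ Finset.range m, β ^ (i + 1 - l) := by
    rw [Fin.sum_univ_succ, Finset.mul_sum, Finset.sum_range]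
    simp [hvdef]
  have hnonneg : 0 ≤ α * ∑ i ∈ Finset.range m, β ^ (i + 1 - l) :=
    mul_nonneg hα (Finset.sum_nonneg fun i _ => pow_nonneg hβ0 _)
  have hv (i : Fin (m + 1)) : 0 ≤ v i := by
    simp only [hvdef]
    split_ifs
    · exact zero_le_one
    · exact mul_nonneg hα (pow_nonneg hβ0 _)
  have hd (i : Fin (m + 1)) : 1 ≤ d i := by
    simp only [hddef]
    split_ifs <;> omega
  have hweight (k : Fin (m + 1) → ℕ) :
      (∏ i ∈ Finset.univ.filter (fun i : Fin (m + 1) => 1 ≤ (i : ℕ) ∧ (i : ℕ) ≤ l), α ^ k i) *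
        (∏ i ∈ Finset.univ.filter (fun i : Fin (m + 1) => l + 1 ≤ (i : ℕ)),
          α ^ k i * β ^ (((i : ℕ) - l) * k i)) = ∏ i, v i ^ k i := by
    rw [Finset.prod_filter, Finset.prod_filter, ← Finset.prod_mul_distrib]
    refine Finset.prod_congr rfl fun i _ => ?_
    rcases eq_or_ne i 0 with rfl | h
    · simp [hvdef]
    · have hi : 1 ≤ (i : ℕ) := Nat.one_le_iff_ne_zero.2 (Fin.val_ne_zero_iff.2 h)
      rcases le_or_gt (i : ℕ) l with h' | h'
      · simp [hvdef, h, hi, h', h'.not_gt, Nat.sub_eq_zero_of_le h']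
      · simp [hvdef, h, h'.not_ge, Nat.succ_le_of_lt h', mul_pow, pow_mul]
  have hdegree (k : Fin (m + 1) → ℕ) : ∑ i, d i * k i =
      k 0 + ∑ i ∈ Finset.univ.filter (fun i : Fin (m + 1) => 1 ≤ (i : ℕ)), (i : ℕ) * k i := by
    rw [Finset.sum_filter, Fin.sum_univ_succ, Fin.sum_univ_succ]
    simp [hddef]
  simp only [mul_assoc, hweight]
  refine (sum_multinomial_mul_prod_pow_le d v hd hv (by linarith) r _ fun k hk => ?_).trans ?_
  · rw [hdegree]
    exact (Finset.mem_filter.1 hk).2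
  · have hle : ∑ i, v i ≤ Real.exp (α * ((l : ℝ) / (1 - β))) := by
      rw [hsum, add_comm]
      exact (add_le_add_left (mul_le_mul_of_nonneg_left
        (sum_range_truncated_geometric_le l m hl hlm β hβ0 hβ1) hα) 1).trans (Real.add_one_le_exp _)
    refine (pow_le_pow_left₀ (Finset.sum_nonneg fun i _ => hv i) hle r).trans_eq ?_
    rw [← Real.exp_nat_mul]
    congr 1
    ring
end
end
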